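/- arXiv:1812.03195 — 2 statements merged into one kernel-verified Lean document; each statement's English description precedes it below -/
import Mathlib

section
/- Every bipartite fast finite simple graph G with at least one vertex satisfies δ(G) ≤ 2·ψ(G), where δ(G) is the minimum degree of G and ψ(G) is the largest integer d ≥ 0 such that G contains K_{d,d} as a (not necessarily induced) subgraph. -/
open SimpleGraph

/-- A set of vertices is independent if no two of its members are adjacent. -/
def IndepVertexSet {V : Type*} (G : SimpleGraph V) (A : Set V) : Prop :=
  ∀ ⦃u⦄, u ∈ A → ∀ ⦃v⦄, v ∈ A → ¬ G.Adj u v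

/-- A graph is bipartite if its vertex set is partitioned into two independent sets. -/
def IsBipartiteGraph {V : Type*} (G : SimpleGraph V) : Prop :=
  ∃ A B : Set V, A ∪ B = Set.univ ∧ Disjoint A B ∧
    IndepVertexSet G A ∧ IndepVertexSet G B

/-- `G` contains an induced subgraph isomorphic to `H`. -/
def HasInducedCopy {V W : Type*} (G : SimpleGraph V) (H : SimpleGraph W) : Prop :=
  ∃ S : Set V, Nonempty (G.induce S ≃g H)

/-- The armchair: a 4-cycle 0-1-2-3 with pendant vertices 4, 5, 6 attached to 0, 1, 2. -/
def armchair : SimpleGraph (Fin 7) :=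
  SimpleGraph.fromRel (fun a b =>
    (a = 0 ∧ b = 1) ∨ (a = 1 ∧ b = 2) ∨ (a = 2 ∧ b = 3) ∨ (a = 3 ∧ b = 0) ∨
    (a = 0 ∧ b = 4) ∨ (a = 1 ∧ b = 5) ∨ (a = 2 ∧ b = 6))

/-- The stirrer: two 4-cycles 0-1-2-3 and 0-1-4-5 sharing exactly the edge 0-1,
with a pendant vertex 6 attached to the endpoint 0 of the shared edge. -/
def stirrer : SimpleGraph (Fin 7) :=
  SimpleGraph.fromRel (fun a b =>
    (a = 0 ∧ b = 1) ∨ (a = 1 ∧ b = 2) ∨ (a = 2 ∧ b = 3) ∨ (a = 3 ∧ b = 0) ∨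
    (a = 1 ∧ b = 4) ∨ (a = 4 ∧ b = 5) ∨ (a = 5 ∧ b = 0) ∨ (a = 0 ∧ b = 6))

/-- The tripod: the star K_{1,3} with each edge subdivided once
(centre 0 with paths 0-1-2, 0-3-4, 0-5-6). -/
def tripod : SimpleGraph (Fin 7) :=
  SimpleGraph.fromRel (fun a b =>
    (a = 0 ∧ b = 1) ∨ (a = 1 ∧ b = 2) ∨ (a = 0 ∧ b = 3) ∨ (a = 3 ∧ b = 4) ∨
    (a = 0 ∧ b = 5) ∨ (a = 5 ∧ b = 6))

/-- A graph is fast if it contains no induced armchair, stirrer or tripod. -/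
def Fast {V : Type*} (G : SimpleGraph V) : Prop :=
  ¬ HasInducedCopy G armchair ∧ ¬ HasInducedCopy G stirrer ∧ ¬ HasInducedCopy G tripod

/-- A graph is hole-free if it contains no induced cycle of length at least 5. -/
def HoleFree {V : Type*} (G : SimpleGraph V) : Prop :=
  ∀ n : ℕ, 5 ≤ n → ¬ HasInducedCopy G (SimpleGraph.cycleGraph n)

/-- `ψ(G)`: the largest `d` such that `G` contains `K_{d,d}` as a (not necessarily
induced) subgraph, i.e. disjoint vertex sets `A`, `B` of size `d` with every vertex of
`A` adjacent to every vertex of `B`. -/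
noncomputable def psi {V : Type*} (G : SimpleGraph V) : ℕ :=
  sSup {d : ℕ | ∃ A B : Finset V, A.card = d ∧ B.card = d ∧ Disjoint A B ∧
    ∀ a ∈ A, ∀ b ∈ B, G.Adj a b}

theorem HasInducedCopy.of_fun {V : Type*} {G : SimpleGraph V} {H : SimpleGraph (Fin 7)}
    (f : Fin 7 → V) (hinj : Function.Injective f)
    (h : ∀ i j, G.Adj (f i) (f j) ↔ H.Adj i j) : HasInducedCopy G H := by
  refine ⟨Set.range f, ⟨RelIso.symm ⟨Equiv.ofInjective f hinj, ?_⟩⟩⟩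
  intro a b
  simp [h]

/-- Forbidden stirrer: along an edge `u v`, missing sets are nested or disjoint. -/
theorem no_stirrer {V : Type*} {G : SimpleGraph V} (c : V → Bool)
    (hc : ∀ a b, G.Adj a b → c a ≠ c b) (hs : ¬ HasInducedCopy G stirrer)
    {v u y r y' q p : V} (huv : G.Adj v u) (huy : G.Adj u y) (huy' : G.Adj u y')
    (hvr : G.Adj v r) (hvq : G.Adj v q) (hvp : G.Adj v p)
    (hyr : G.Adj y r) (hyq : ¬ G.Adj y q) (hyp : ¬ G.Adj y p)
    (hyr' : ¬ G.Adj y' r) (hyq' : G.Adj y' q) (hyp' : ¬ G.Adj y' p) : False := by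
  apply hs
  have hc2 : ∀ a b, G.Adj a b → c b = !c a := by
    intro a b h
    have := hc a b h
    revert this
    cases c a <;> cases c b <;> simp
  have hc' : ∀ a b, c a = c b → ¬ G.Adj a b := fun a b h h' => hc a b h' h
  have hsym : ∀ a b, G.Adj a b → G.Adj b a := fun a b h => h.symm
  have e1 := hc2 _ _ huv
  have e2 := hc2 _ _ huy
  have e3 := hc2 _ _ huy'
  have e4 := hc2 _ _ hvr
  have e5 := hc2 _ _ hvq
  have e6 := hc2 _ _ hvp
  obtain ⟨k, hk⟩ : ∃ k, c v = k := ⟨_, rfl⟩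
  rw [hk] at e1 e4 e5 e6
  rw [e1, Bool.not_not] at e2 e3
  have hkk : (!k) ≠ k := by cases k <;> simp
  have n1 : v ≠ y := by rintro rfl; exact hyq hvq
  have n2 : v ≠ y' := by rintro rfl; exact hyr' hvr
  have n3 : y ≠ y' := by rintro rfl; exact hyq hyq'
  have n4 : u ≠ r := by rintro rfl; exact hyr' huy'.symm
  have n5 : u ≠ q := by rintro rfl; exact hyq huy.symm
  have n6 : u ≠ p := by rintro rfl; exact hyp huy.symm
  have n7 : r ≠ q := by rintro rfl; exact hyq hyr
  have n8 : r ≠ p := by rintro rfl; exact hyp hyr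
  have n9 : q ≠ p := by rintro rfl; exact hyp' hyq'
  refine HasInducedCopy.of_fun ![v, u, y, r, y', q, p] ?_ ?_
  · intro i j hij
    fin_cases i <;> fin_cases j <;> simp at hij ⊢ <;> grind
  · intro i j
    fin_cases i <;> fin_cases j <;> simp [stirrer] <;> grind

theorem no_tripod {V : Type*} {G : SimpleGraph V} (c : V → Bool)
    (hc : ∀ a b, G.Adj a b → c a ≠ c b) (hs : ¬ HasInducedCopy G tripod)
    {v u1 u2 u3 y1 y2 y3 : V} (h1 : G.Adj v u1) (h2 : G.Adj v u2) (h3 : G.Adj v u3)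
    (h11 : G.Adj y1 u1) (h12 : ¬ G.Adj y1 u2) (h13 : ¬ G.Adj y1 u3)
    (h21 : ¬ G.Adj y2 u1) (h22 : G.Adj y2 u2) (h23 : ¬ G.Adj y2 u3)
    (h31 : ¬ G.Adj y3 u1) (h32 : ¬ G.Adj y3 u2) (h33 : G.Adj y3 u3) : False := by
  apply hs
  have hc2 : ∀ a b, G.Adj a b → c b = !c a := by
    intro a b h
    have := hc a b h
    revert this
    cases c a <;> cases c b <;> simp
  have hc' : ∀ a b, c a = c b → ¬ G.Adj a b := fun a b h h' => hc a b h' h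
  have hsym : ∀ a b, G.Adj a b → G.Adj b a := fun a b h => h.symm
  have e1 := hc2 _ _ h1
  have e2 := hc2 _ _ h2
  have e3 := hc2 _ _ h3
  have e4 := hc2 _ _ h11.symm
  have e5 := hc2 _ _ h22.symm
  have e6 := hc2 _ _ h33.symm
  obtain ⟨k, hk⟩ : ∃ k, c v = k := ⟨_, rfl⟩
  rw [hk] at e1 e2 e3
  rw [e1, Bool.not_not] at e4
  rw [e2, Bool.not_not] at e5
  rw [e3, Bool.not_not] at e6
  have hkk : (!k) ≠ k := by cases k <;> simp
  have n1 : v ≠ y1 := by rintro rfl; exact h12 h2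
  have n2 : v ≠ y2 := by rintro rfl; exact h21 h1
  have n3 : v ≠ y3 := by rintro rfl; exact h31 h1
  have n4 : y1 ≠ y2 := by rintro rfl; exact h12 h22
  have n5 : y1 ≠ y3 := by rintro rfl; exact h13 h33
  have n6 : y2 ≠ y3 := by rintro rfl; exact h23 h33
  have n7 : u1 ≠ u2 := by rintro rfl; exact h12 h11
  have n8 : u1 ≠ u3 := by rintro rfl; exact h13 h11
  have n9 : u2 ≠ u3 := by rintro rfl; exact h23 h22
  refine HasInducedCopy.of_fun ![v, u1, y1, u2, y2, u3, y3] ?_ ?_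
  · intro i j hij
    fin_cases i <;> fin_cases j <;> simp at hij ⊢ <;> grind
  · intro i j
    fin_cases i <;> fin_cases j <;> simp [tripod] <;> grind

/-- Existence of a (not necessarily balanced) biclique with both sides of size at least `t`. -/
def Bic {V : Type*} (G : SimpleGraph V) (t : ℕ) : Prop :=
  ∃ S T : Finset V, t ≤ S.card ∧ t ≤ T.card ∧ ∀ a ∈ S, ∀ b ∈ T, G.Adj a b

theorem Bic.le_psi {V : Type*} [Fintype V] {G : SimpleGraph V} {t : ℕ} (h : Bic G t) :
    t ≤ psi G := by
  obtain ⟨S, T, hS, hT, hST⟩ := h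
  obtain ⟨S', hS', hS''⟩ := Finset.exists_subset_card_eq hS
  obtain ⟨T', hT', hT''⟩ := Finset.exists_subset_card_eq hT
  refine le_csSup ⟨Fintype.card V, ?_⟩ ⟨S', T', hS'', hT'', ?_, ?_⟩
  · rintro d ⟨A, B, rfl, -⟩
    exact Finset.card_le_univ A
  · rw [Finset.disjoint_left]
    intro a ha hb
    exact (hST a (hS' ha) a (hT' hb)).ne rfl
  · intro a ha b hb
    exact hST a (hS' ha) b (hT' hb)

open Classical in
/-- Counting argument. -/
theorem counting {V : Type*} [Fintype V] {G : SimpleGraph V} {d t : ℕ} (ht : 2 * t ≤ d + 1)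
    (htd : t ≤ d)
    (Y X : Finset V) (r : V → V → Prop) (_hsymm : ∀ a b, r a b → r b a)
    (htrans : ∀ a ∈ Y, ∀ b ∈ Y, ∀ e ∈ Y, r a b → r b e → r a e)
    (h1 : ∀ x ∈ X, ∀ y ∈ Y, ∀ y' ∈ Y, ¬ G.Adj y x → ¬ G.Adj y' x → r y y')
    (h2 : ∀ y ∈ Y, ∃ y0 ∈ Y, r y y0 ∧ r y0 y0 ∧ ∃ N : Finset V, N ⊆ X ∧ d ≤ N.card ∧
      ∀ x ∈ N, ∀ y' ∈ Y, r y' y0 → G.Adj y' x)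
    (hY : d ≤ Y.card) (hX : t ≤ X.card) : Bic G t := by
  by_contra hno
  let Z : Finset V → Finset V := fun J => X.filter (fun x => ∀ y ∈ Y \ J, G.Adj y x)
  have hfail : ∀ J, t ≤ (Z J).card → (Y \ J).card < t := by
    intro J hJ
    by_contra hlt
    refine hno ⟨Y \ J, Z J, not_lt.1 hlt, hJ, ?_⟩
    intro a ha b hb
    exact (Finset.mem_filter.1 hb).2 a ha
  let F : Finset (Finset V) := Y.powerset.filter
    (fun J => t ≤ (Z J).card ∧ ∀ y ∈ J, ∀ y' ∈ Y, r y y' → y' ∈ J)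
  have hF : F.Nonempty := by
    refine ⟨Y, ?_⟩
    simp only [F, Finset.mem_filter, Finset.mem_powerset, Finset.Subset.refl, true_and]
    refine ⟨?_, fun _ _ y' h _ => h⟩
    have hZ : Z Y = X := Finset.filter_true_of_mem (fun x _ y hy => by simp at hy)
    rw [hZ]
    exact hX
  obtain ⟨J, hJF, hmin⟩ := Finset.exists_min_image F Finset.card hF
  simp only [F, Finset.mem_filter, Finset.mem_powerset] at hJF hmin
  obtain ⟨hJY, hJt, hJc⟩ := hJF
  have hYJ := hfail J hJt
  have hcard : (Y \ J).card + J.card = Y.card := Finset.card_sdiff_add_card_eq_card hJY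
  have hJne : J.Nonempty := by
    rw [Finset.nonempty_iff_ne_empty]
    rintro rfl
    simp at hYJ
    omega
  obtain ⟨k, hk⟩ := hJne
  obtain ⟨y0, hy0, hky0, hrefl, N, hNX, hNd, hN⟩ := h2 k (hJY hk)
  have hy0J : y0 ∈ J := hJc k hk y0 hy0 hky0
  let J' := J.filter (fun y => ¬ r y y0)
  have hJ'J : J' ⊆ J := Finset.filter_subset _ _
  have hJ't : (Z J').card < t := by
    by_contra hlt
    have := hmin J' ⟨hJ'J.trans hJY, not_lt.1 hlt, ?_⟩
    · have h3 : J' ⊂ J := by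
        refine Finset.ssubset_iff_subset_ne.2 ⟨hJ'J, fun h => ?_⟩
        have := h ▸ hy0J
        simp [J', hrefl] at this
      exact absurd (Finset.card_lt_card h3) (not_lt.2 this)
    · intro y hy y' hy' hr
      simp only [J', Finset.mem_filter] at hy ⊢
      exact ⟨hJc y hy.1 y' hy' hr, fun h => hy.2 (htrans _ (hJY hy.1) _ hy' _ hy0 hr h)⟩
  have hsub : N ⊆ Z J' ∪ Z (Y \ J) := by
    intro x hx
    have hxX := hNX hx
    by_cases hex : ∃ y ∈ J, ¬ G.Adj y x
    · obtain ⟨y, hy, hyx⟩ := hex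
      refine Finset.mem_union_left _ (Finset.mem_filter.2 ⟨hxX, ?_⟩)
      intro y' hy'
      simp only [J', Finset.mem_sdiff, Finset.mem_filter, not_and, not_not] at hy'
      by_contra hn
      by_cases hy'J : y' ∈ J
      · exact hn (hN x hx y' hy'.1 (hy'.2 hy'J))
      · exact hy'J (hJc y hy y' hy'.1 (h1 x hxX y (hJY hy) y' hy'.1 hyx hn))
    · push Not at hex
      refine Finset.mem_union_right _ (Finset.mem_filter.2 ⟨hxX, ?_⟩)
      intro y' hy'
      simp only [Finset.mem_sdiff, not_and, not_not] at hy'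
      exact hex y' (hy'.2 hy'.1)
  have h4 := (Finset.card_le_card hsub).trans (Finset.card_union_le _ _)
  have h5 := hfail (Y \ J) (by omega)
  have h6 : Y \ (Y \ J) = J := Finset.sdiff_sdiff_eq_self hJY
  rw [h6] at h5
  omega

section Core

open Classical

variable {V : Type*} [Fintype V]

/-- Neighbours. -/
noncomputable def NN (G : SimpleGraph V) (v : V) : Finset V :=
  Finset.univ.filter (fun x => G.Adj v x)

/-- Neighbours of `v` missed by `y`. -/
noncomputable def MM (G : SimpleGraph V) (v y : V) : Finset V :=
  Finset.univ.filter (fun x => G.Adj v x ∧ ¬ G.Adj y x)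

/-- Common neighbours of `v` and `y`. -/
noncomputable def II (G : SimpleGraph V) (v y : V) : Finset V :=
  Finset.univ.filter (fun x => G.Adj v x ∧ G.Adj y x)

theorem mem_NN {G : SimpleGraph V} {v x : V} : x ∈ NN G v ↔ G.Adj v x := by simp [NN]

theorem mem_MM {G : SimpleGraph V} {v y x : V} :
    x ∈ MM G v y ↔ G.Adj v x ∧ ¬ G.Adj y x := by simp [MM]

theorem mem_II {G : SimpleGraph V} {v y x : V} :
    x ∈ II G v y ↔ G.Adj v x ∧ G.Adj y x := by simp [II]

theorem card_II_add {G : SimpleGraph V} {v y : V} :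
    (II G v y).card + (MM G v y).card = (NN G v).card := by
  have := Finset.card_filter_add_card_filter_not (s := NN G v) (fun x => G.Adj y x)
  rw [← this]
  congr 2 <;> ext x <;> simp [mem_II, mem_MM, mem_NN]

variable {G : SimpleGraph V}

/-- The nested-or-disjoint condition coming from stirrer-freeness. -/
def Nest (G : SimpleGraph V) : Prop :=
  ∀ v u y y' p, G.Adj v u → G.Adj u y → G.Adj u y' → p ∈ MM G v y → p ∈ MM G v y' →
    MM G v y ⊆ MM G v y' ∨ MM G v y' ⊆ MM G v y

theorem nest_of (c : V → Bool)
    (hc : ∀ a b, G.Adj a b → c a ≠ c b) (hs : ¬ HasInducedCopy G stirrer) : Nest G := by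
  intro v u y y' p huv huy huy' hp hp'
  by_contra hcon
  rw [not_or, Finset.not_subset, Finset.not_subset] at hcon
  obtain ⟨⟨q, hq, hq'⟩, r, hr, hr'⟩ := hcon
  rw [mem_MM] at *
  have hq'' : G.Adj y' q := by by_contra h; exact hq' ⟨hq.1, h⟩
  have hr'' : G.Adj y r := by by_contra h; exact hr' ⟨hr.1, h⟩
  exact no_stirrer c hc hs huv huy huy' hr.1 hq.1 hp.1 hr'' hq.2 hp.2 hr.2 hq'' hp'.2

theorem Nest.trans' (hn : Nest G) {v u y y' y'' p q : V} (huv : G.Adj v u) (h : G.Adj u y)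
    (h' : G.Adj u y') (h'' : G.Adj u y'') (hp : p ∈ MM G v y) (hp' : p ∈ MM G v y')
    (hq' : q ∈ MM G v y') (hq'' : q ∈ MM G v y'') :
    ∃ z, z ∈ MM G v y ∧ z ∈ MM G v y'' := by
  rw [mem_MM] at hp hp' hq' hq''
  have hs : ∀ a b, ¬ G.Adj a b → ¬ G.Adj b a := fun a b h h' => h h'.symm
  have key := hn u v p q y' huv.symm hp.1 hq'.1
    (mem_MM.2 ⟨h', hs _ _ hp'.2⟩) (mem_MM.2 ⟨h', hs _ _ hq'.2⟩)
  rcases key with key | key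
  · have := key (mem_MM.2 ⟨h, hs _ _ hp.2⟩)
    rw [mem_MM] at this
    exact ⟨q, mem_MM.2 ⟨hq'.1, hs _ _ this.2⟩, mem_MM.2 hq''⟩
  · have := key (mem_MM.2 ⟨h'', hs _ _ hq''.2⟩)
    rw [mem_MM] at this
    exact ⟨p, mem_MM.2 hp, mem_MM.2 ⟨hp.1, hs _ _ this.2⟩⟩

/-- Step 1: some neighbour `u` of `v` avoids all small intersections. -/
theorem step_one (c : V → Bool)
    (hc : ∀ a b, G.Adj a b → c a ≠ c b) (ht : ¬ HasInducedCopy G tripod) (hn : Nest G)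
    {v : V} {t : ℕ} (hvt : 2 * t ≤ (NN G v).card + 1) (ht0 : 0 < t) :
    ∃ u, G.Adj v u ∧ ∀ y, G.Adj u y → t ≤ (II G v y).card := by
  by_contra hcon
  push Not at hcon
  have hcomp : ∀ y y' u, G.Adj v u → G.Adj u y → G.Adj u y' → (II G v y).card < t →
      (II G v y').card < t → II G v y ⊆ II G v y' ∨ II G v y' ⊆ II G v y := by
    intro y y' u huv hy hy' hyt hyt'
    have hm : ¬ Disjoint (MM G v y) (MM G v y') := by
      intro hd
      have h1 := Finset.card_union_of_disjoint hd
      have h2 : MM G v y ∪ MM G v y' ⊆ NN G v := by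
        intro x
        simp only [Finset.mem_union, mem_MM, mem_NN]
        tauto
      have h3 := Finset.card_le_card h2
      have h4 := card_II_add (G := G) (v := v) (y := y)
      have h5 := card_II_add (G := G) (v := v) (y := y')
      omega
    rw [Finset.not_disjoint_iff] at hm
    obtain ⟨p, hp, hp'⟩ := hm
    rcases hn v u y y' p huv hy hy' hp hp' with h | h
    · right
      intro x hx
      rw [mem_II] at *
      refine ⟨hx.1, ?_⟩
      by_contra hxy
      exact (mem_MM.1 (h (mem_MM.2 ⟨hx.1, hxy⟩))).2 hx.2
    · left
      intro x hx
      rw [mem_II] at *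
      refine ⟨hx.1, ?_⟩
      by_contra hxy
      exact (mem_MM.1 (h (mem_MM.2 ⟨hx.1, hxy⟩))).2 hx.2
  let S : Finset V := Finset.univ.filter
    (fun y => (II G v y).card < t ∧ ∃ u, G.Adj v u ∧ G.Adj u y)
  have hNpos : 0 < (NN G v).card := by omega
  obtain ⟨u0, hu0⟩ := Finset.card_pos.1 hNpos
  rw [mem_NN] at hu0
  obtain ⟨y0, hy0, hy0t⟩ := hcon u0 hu0
  obtain ⟨y1, hy1, hmax1⟩ := Finset.exists_max_image S (fun y => (II G v y).card)
    ⟨y0, by simp only [S, Finset.mem_filter, Finset.mem_univ, true_and]; exact ⟨hy0t, u0, hu0, hy0⟩⟩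
  simp only [S, Finset.mem_filter, Finset.mem_univ, true_and] at hy1 hmax1
  obtain ⟨hy1t, u1, hu1, hu1y1⟩ := hy1
  have hex2 : ∃ u2, G.Adj v u2 ∧ ¬ G.Adj y1 u2 := by
    by_contra h
    push Not at h
    have : NN G v ⊆ II G v y1 := fun x hx => mem_II.2 ⟨mem_NN.1 hx, h x (mem_NN.1 hx)⟩
    have := Finset.card_le_card this
    omega
  obtain ⟨u2, hu2, hy1u2⟩ := hex2
  obtain ⟨y2', hy2', hy2t'⟩ := hcon u2 hu2
  obtain ⟨y2, hy2, hmax2⟩ := Finset.exists_max_image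
    (Finset.univ.filter (fun y => (II G v y).card < t ∧ G.Adj u2 y)) (fun y => (II G v y).card)
    ⟨y2', by simp only [Finset.mem_filter, Finset.mem_univ, true_and]; exact ⟨hy2t', hy2'⟩⟩
  simp only [Finset.mem_filter, Finset.mem_univ, true_and] at hy2 hmax2
  obtain ⟨hy2t, hu2y2⟩ := hy2
  have hex3 : ∃ u3, G.Adj v u3 ∧ ¬ G.Adj y1 u3 ∧ ¬ G.Adj y2 u3 := by
    by_contra h
    push Not at h
    have : NN G v ⊆ II G v y1 ∪ II G v y2 := by
      intro x hx
      rw [mem_NN] at hx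
      rw [Finset.mem_union, mem_II, mem_II]
      have := h x hx
      tauto
    have := (Finset.card_le_card this).trans (Finset.card_union_le _ _)
    omega
  obtain ⟨u3, hu3, hy1u3, hy2u3⟩ := hex3
  obtain ⟨y3, hu3y3, hy3t⟩ := hcon u3 hu3
  have hd1 : ∀ y w, (II G v y).card < t → G.Adj v w → G.Adj w y → ¬ G.Adj y1 w →
      ∀ x, G.Adj v x → G.Adj y1 x → ¬ G.Adj y x := by
    intro y w hyt hw hwy hy1w x hx hxy1 hxy
    have hle := hmax1 y ⟨hyt, w, hw, hwy⟩
    have hsub : II G v y ⊆ II G v y1 := by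
      rcases hcomp y y1 x hx hxy.symm hxy1.symm hyt hy1t with h | h
      · exact h
      · rw [Finset.eq_of_subset_of_card_le h hle]
    exact hy1w (mem_II.1 (hsub (mem_II.2 ⟨hw, hwy.symm⟩))).2
  have hd2 : ∀ x, G.Adj v x → G.Adj y2 x → ¬ G.Adj y3 x := by
    intro x hx hxy2 hxy3
    rcases hcomp y3 y2 x hx hxy3.symm hxy2.symm hy3t hy2t with h | h
    · exact hy2u3 (mem_II.1 (h (mem_II.2 ⟨hu3, hu3y3.symm⟩))).2
    · have h2 := (mem_II.1 (h (mem_II.2 ⟨hu2, hu2y2.symm⟩))).2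
      have := hmax2 y3 ⟨hy3t, h2.symm⟩
      have h5 := Finset.eq_of_subset_of_card_le h this
      have h6 : u3 ∈ II G v y2 := h5 ▸ (mem_II.2 ⟨hu3, hu3y3.symm⟩)
      exact hy2u3 (mem_II.1 h6).2
  exact no_tripod c hc ht hu1 hu2 hu3 hu1y1.symm hy1u2 hy1u3
    (hd1 y2 u2 hy2t hu2 hu2y2 hy1u2 u1 hu1 hu1y1.symm) hu2y2.symm hy2u3
    (hd1 y3 u3 hy3t hu3 hu3y3 hy1u3 u1 hu1 hu1y1.symm) (hd2 u2 hu2 hu2y2.symm) hu3y3.symm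

/-- Step 2: if two missing sets dominate all others we are done. -/
theorem step_two {v u y1 y2 : V} {t : ℕ}
    (hut : 2 * t ≤ (NN G u).card + 1)
    (h1 : t ≤ (II G v y1).card) (h2 : t ≤ (II G v y2).card)
    (hall : ∀ y, G.Adj u y → MM G v y ⊆ MM G v y1 ∨ MM G v y ⊆ MM G v y2) : Bic G t := by
  have hsub : NN G u ⊆ (NN G u).filter (fun y => MM G v y ⊆ MM G v y1) ∪
      (NN G u).filter (fun y => MM G v y ⊆ MM G v y2) := by
    intro y hy
    have := hall y (mem_NN.1 hy)
    simp only [Finset.mem_union, Finset.mem_filter]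
    tauto
  have hcard := (Finset.card_le_card hsub).trans (Finset.card_union_le _ _)
  have hb : ∀ z, ∀ a ∈ (NN G u).filter (fun y => MM G v y ⊆ MM G v z), ∀ b ∈ II G v z,
      G.Adj a b := by
    intro z a ha b hb
    rw [Finset.mem_filter] at ha
    rw [mem_II] at hb
    by_contra hab
    exact (mem_MM.1 (ha.2 (mem_MM.2 ⟨hb.1, hab⟩))).2 hb.2
  by_cases h : t ≤ ((NN G u).filter (fun y => MM G v y ⊆ MM G v y1)).card
  · exact ⟨_, _, h, h1, hb y1⟩
  · exact ⟨_, _, by omega, h2, hb y2⟩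

/-- Step 3: three pairwise disjoint missing sets. -/
theorem step_three (c : V → Bool)
    (hc : ∀ a b, G.Adj a b → c a ≠ c b) (hs : ¬ HasInducedCopy G stirrer) (hn : Nest G)
    {v u : V} {t : ℕ} (hmin : ∀ w, (NN G v).card ≤ (NN G w).card)
    (hvt : 2 * t ≤ (NN G v).card + 1) (htd : t ≤ (NN G v).card)
    (huv : G.Adj v u) {y1 y2 y3 : V} (h1 : G.Adj u y1) (h2 : G.Adj u y2) (h3 : G.Adj u y3)
    (hne1 : (MM G v y1).Nonempty) (hne2 : (MM G v y2).Nonempty) (hne3 : (MM G v y3).Nonempty)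
    (h12 : Disjoint (MM G v y1) (MM G v y2)) (h13 : Disjoint (MM G v y1) (MM G v y3))
    (h23 : Disjoint (MM G v y2) (MM G v y3)) : Bic G t := by
  have hA : ∀ y y' y'' w, G.Adj u y → G.Adj u y' → G.Adj u y'' → (MM G v y').Nonempty →
      (MM G v y'').Nonempty → Disjoint (MM G v y) (MM G v y') →
      Disjoint (MM G v y) (MM G v y'') → Disjoint (MM G v y') (MM G v y'') →
      ¬ G.Adj v w → G.Adj y w → G.Adj y' w ∨ G.Adj y'' w := by
    intro y y' y'' w hy hy' hy'' hne' hne'' hd1 hd2 hd3 hvw hyw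
    by_contra hcon
    rw [not_or] at hcon
    obtain ⟨p', hp'⟩ := hne'
    obtain ⟨p'', hp''⟩ := hne''
    have a1 := Finset.disjoint_right.1 hd1 hp'
    have a2 := Finset.disjoint_right.1 hd2 hp''
    have a3 := Finset.disjoint_right.1 hd3 hp''
    have a4 := Finset.disjoint_left.1 hd3 hp'
    rw [mem_MM] at *
    have b1 : G.Adj y p' := by tauto
    have b2 : G.Adj y p'' := by tauto
    have b3 : G.Adj y' p'' := by tauto
    have b4 : G.Adj y'' p' := by tauto
    exact no_stirrer c hc hs hy.symm hy' hy'' b2 b1 hyw b3 hp'.2 hcon.1 hp''.2 b4 hcon.2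
  have hdt : ∀ a b e, G.Adj u a → G.Adj u b → G.Adj u e →
      ¬ Disjoint (MM G v a) (MM G v b) → ¬ Disjoint (MM G v b) (MM G v e) →
      ¬ Disjoint (MM G v a) (MM G v e) := by
    intro a b e ha hb he hab hbe
    rw [Finset.not_disjoint_iff] at *
    obtain ⟨p, hp, hp'⟩ := hab
    obtain ⟨q, hq, hq'⟩ := hbe
    exact hn.trans' huv ha hb he hp hp' hq hq'
  have hother : ∀ y, G.Adj u y → ∃ y' y'', G.Adj u y' ∧ G.Adj u y'' ∧ (MM G v y').Nonempty ∧
      (MM G v y'').Nonempty ∧ Disjoint (MM G v y) (MM G v y') ∧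
      Disjoint (MM G v y) (MM G v y'') ∧ Disjoint (MM G v y') (MM G v y'') := by
    intro y hy
    by_cases d1 : Disjoint (MM G v y) (MM G v y1)
    · by_cases d2 : Disjoint (MM G v y) (MM G v y2)
      · exact ⟨y1, y2, h1, h2, hne1, hne2, d1, d2, h12⟩
      · refine ⟨y1, y3, h1, h3, hne1, hne3, d1, ?_, h13⟩
        by_contra d3
        exact hdt y2 y y3 h2 hy h3 (fun h => d2 h.symm) d3 h23
    · refine ⟨y2, y3, h2, h3, hne2, hne3, ?_, ?_, h23⟩
      · by_contra d3
        exact hdt y1 y y2 h1 hy h2 (fun h => d1 h.symm) d3 h12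
      · by_contra d3
        exact hdt y1 y y3 h1 hy h3 (fun h => d1 h.symm) d3 h13
  have hB1 : ∀ y z w, G.Adj u y → G.Adj u z → (MM G v y).Nonempty → (MM G v z).Nonempty →
      ¬ G.Adj v w → ¬ G.Adj y w → G.Adj z w → Disjoint (MM G v y) (MM G v z) →
      ∀ x, G.Adj u x → (MM G v x).Nonempty → Disjoint (MM G v y) (MM G v x) → G.Adj x w := by
    intro y z w hy hz hney hnez hvw hyw hzw hyz x hx hnex hyx
    by_cases hzx : Disjoint (MM G v z) (MM G v x)
    · rcases hA z y x w hz hy hx hney hnex hyz.symm hzx hyx hvw hzw with h | h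
      · exact absurd h hyw
      · exact h
    · -- go through a third class
      obtain ⟨a, ha, hnea, hya, hza⟩ : ∃ a, G.Adj u a ∧ (MM G v a).Nonempty ∧
          Disjoint (MM G v y) (MM G v a) ∧ Disjoint (MM G v z) (MM G v a) := by
        obtain ⟨a, b, ha, hb, hnea, hneb, d1, d2, d3⟩ := hother y hy
        by_cases hza : Disjoint (MM G v z) (MM G v a)
        · exact ⟨a, ha, hnea, d1, hza⟩
        · refine ⟨b, hb, hneb, d2, ?_⟩
          by_contra hzb
          exact hdt a z b ha hz hb (fun h => hza h.symm) hzb d3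
      have haw : G.Adj a w := by
        rcases hA z y a w hz hy ha hney hnea hyz.symm hza hya hvw hzw with h | h
        · exact absurd h hyw
        · exact h
      have hax : Disjoint (MM G v a) (MM G v x) := by
        by_contra h
        exact hdt z x a hz hx ha hzx (fun h' => h h'.symm) hza
      rcases hA a y x w ha hy hx hney hnex hya.symm hax hyx hvw haw with h | h
      · exact absurd h hyw
      · exact h
  have hB : ∀ w z, ¬ G.Adj v w → G.Adj u z → (MM G v z).Nonempty → G.Adj z w →
      ∀ y, G.Adj u y → (MM G v y).Nonempty → G.Adj y w := by
    intro w z hvw hz hnez hzw y hy hney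
    by_contra hyw
    obtain ⟨a, b, ha, hb, hnea, hneb, d1, d2, d3⟩ := hother y hy
    have hall : ∀ x, G.Adj u x → (MM G v x).Nonempty → Disjoint (MM G v y) (MM G v x) →
        G.Adj x w := by
      by_cases hyz : Disjoint (MM G v y) (MM G v z)
      · exact hB1 y z w hy hz hney hnez hvw hyw hzw hyz
      · have hza : Disjoint (MM G v z) (MM G v a) := by
          by_contra h
          exact hdt y z a hy hz ha hyz h d1
        have hzb : Disjoint (MM G v z) (MM G v b) := by
          by_contra h
          exact hdt y z b hy hz hb hyz h d2
        rcases hA z a b w hz ha hb hnea hneb hza hzb d3 hvw hzw with h | h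
        · exact hB1 y a w hy ha hney hnea hvw hyw h d1
        · exact hB1 y b w hy hb hney hneb hvw hyw h d2
    obtain ⟨w', hyw', hvw'⟩ : ∃ w', G.Adj y w' ∧ ¬ G.Adj v w' := by
      by_contra h
      push Not at h
      have hsub : NN G y ⊆ II G v y := fun x hx =>
        mem_II.2 ⟨h x (mem_NN.1 hx), mem_NN.1 hx⟩
      have e1 := Finset.card_le_card hsub
      have e2 := card_II_add (G := G) (v := v) (y := y)
      have e3 := hmin y
      have e4 := Finset.card_pos.2 hney
      omega
    obtain ⟨x, hx, hnex, hyx, hxw'⟩ : ∃ x, G.Adj u x ∧ (MM G v x).Nonempty ∧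
        Disjoint (MM G v y) (MM G v x) ∧ G.Adj x w' := by
      rcases hA y a b w' hy ha hb hnea hneb d1 d2 d3 hvw' hyw' with h | h
      · exact ⟨a, ha, hnea, d1, h⟩
      · exact ⟨b, hb, hneb, d2, h⟩
    have hxw := hall x hx hnex hyx
    obtain ⟨p, hp⟩ := hney
    have hp2 := Finset.disjoint_left.1 hyx hp
    rw [mem_MM] at hp hp2
    have hxp : G.Adj x p := by tauto
    rcases hn x u y v w hx.symm hy huv.symm (mem_MM.2 ⟨hxw, hyw⟩) (mem_MM.2 ⟨hxw, hvw⟩) with h | h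
    · exact (mem_MM.1 (h (mem_MM.2 ⟨hxp, hp.2⟩))).2 hp.1
    · exact (mem_MM.1 (h (mem_MM.2 ⟨hxw', hvw'⟩))).2 hyw'
  let r : V → V → Prop := fun a b => (MM G v a = ∅ ∧ MM G v b = ∅) ∨
    ¬ Disjoint (MM G v a) (MM G v b)
  let X : Finset V := Finset.univ.filter (fun x => G.Adj v x ∨
    ∃ z, G.Adj u z ∧ (MM G v z).Nonempty ∧ G.Adj z x)
  refine counting (G := G) (d := (NN G v).card) hvt htd (NN G u) X r ?_ ?_ ?_ ?_ (hmin u) ?_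
  · rintro a b (h | h)
    · exact Or.inl h.symm
    · exact Or.inr (fun h' => h h'.symm)
  · rintro a ha b hb e he (h | h) (h' | h')
    · exact Or.inl ⟨h.1, h'.2⟩
    · rw [h.2] at h'
      simp at h'
    · rw [h'.1] at h
      simp at h
    · exact Or.inr (hdt a b e (mem_NN.1 ha) (mem_NN.1 hb) (mem_NN.1 he) h h')
  · intro x hx y hy y' hy' hyx hyx'
    rw [mem_NN] at hy hy'
    by_cases hvx : G.Adj v x
    · right
      rw [Finset.not_disjoint_iff]
      exact ⟨x, mem_MM.2 ⟨hvx, hyx⟩, mem_MM.2 ⟨hvx, hyx'⟩⟩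
    · left
      simp only [X, Finset.mem_filter, Finset.mem_univ, true_and, hvx, false_or] at hx
      obtain ⟨z, hz, hnez, hzx⟩ := hx
      constructor
      · by_contra h
        exact hyx (hB x z hvx hz hnez hzx y hy (Finset.nonempty_iff_ne_empty.2 h))
      · by_contra h
        exact hyx' (hB x z hvx hz hnez hzx y' hy' (Finset.nonempty_iff_ne_empty.2 h))
  · intro y hy
    rw [mem_NN] at hy
    by_cases hye : MM G v y = ∅
    · have hv : MM G v v = ∅ := by
        ext x; simp [mem_MM]
      refine ⟨v, mem_NN.2 huv.symm, Or.inl ⟨hye, hv⟩, Or.inl ⟨hv, hv⟩, NN G v, ?_, le_rfl, ?_⟩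
      · intro x hx
        simp only [X, Finset.mem_filter, Finset.mem_univ, true_and]
        exact Or.inl (mem_NN.1 hx)
      · intro x hx y' hy' hr
        have he : MM G v y' = ∅ := by
          rcases hr with h | h
          · exact h.1
          · rw [hv] at h; simp at h
        by_contra h
        have : x ∈ MM G v y' := mem_MM.2 ⟨mem_NN.1 hx, h⟩
        rw [he] at this
        simp at this
    · have hney := Finset.nonempty_iff_ne_empty.2 hye
      have hself : ∀ z, (MM G v z).Nonempty → ¬ Disjoint (MM G v z) (MM G v z) := by
        intro z hz h
        rw [disjoint_self] at h
        exact Finset.nonempty_iff_ne_empty.1 hz h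
      obtain ⟨y0, hy0, hmax⟩ := Finset.exists_max_image
        ((NN G u).filter (fun z => ¬ Disjoint (MM G v y) (MM G v z)))
        (fun z => (MM G v z).card)
        ⟨y, Finset.mem_filter.2 ⟨mem_NN.2 hy, hself y hney⟩⟩
      simp only [Finset.mem_filter, mem_NN] at hy0 hmax
      have hne0 : (MM G v y0).Nonempty := by
        rw [Finset.nonempty_iff_ne_empty]
        intro h
        have := hy0.2
        rw [h] at this
        simp at this
      refine ⟨y0, mem_NN.2 hy0.1, Or.inr hy0.2, Or.inr (hself y0 hne0), NN G y0, ?_, hmin y0, ?_⟩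
      · intro x hx
        simp only [X, Finset.mem_filter, Finset.mem_univ, true_and]
        exact Or.inr ⟨y0, hy0.1, hne0, mem_NN.1 hx⟩
      · intro x hx y' hy' hr
        rw [mem_NN] at hx hy'
        have hd : ¬ Disjoint (MM G v y') (MM G v y0) := by
          rcases hr with h | h
          · exact absurd h.2 (Finset.nonempty_iff_ne_empty.1 hne0)
          · exact h
        have hne' : (MM G v y').Nonempty := by
          rw [Finset.nonempty_iff_ne_empty]
          intro h
          rw [h] at hd
          simp at hd
        by_cases hvx : G.Adj v x
        · have hsub : MM G v y' ⊆ MM G v y0 := by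
            have hyy' := hdt y y0 y' hy hy0.1 hy' hy0.2 (fun h => hd h.symm)
            have hle := hmax y' ⟨hy', hyy'⟩
            rw [Finset.not_disjoint_iff] at hd
            obtain ⟨p, hp, hp'⟩ := hd
            rcases hn v u y' y0 p huv hy' hy0.1 hp hp' with h | h
            · exact h
            · rw [Finset.eq_of_subset_of_card_le h hle]
          by_contra h
          exact (mem_MM.1 (hsub (mem_MM.2 ⟨hvx, h⟩))).2 hx
        · exact hB x y0 hvx hy0.1 hne0 hx y' hy' hne'
  · refine htd.trans (Finset.card_le_card ?_)
    intro x hx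
    simp only [X, Finset.mem_filter, Finset.mem_univ, true_and]
    exact Or.inl (mem_NN.1 hx)

theorem core (c : V → Bool)
    (hc : ∀ a b, G.Adj a b → c a ≠ c b) (hs : ¬ HasInducedCopy G stirrer)
    (htr : ¬ HasInducedCopy G tripod) {v : V} {t : ℕ}
    (hmin : ∀ w, (NN G v).card ≤ (NN G w).card)
    (hvt : 2 * t ≤ (NN G v).card + 1) (ht0 : 0 < t) : Bic G t := by
  have hn := nest_of c hc hs
  obtain ⟨u, huv, hu⟩ := step_one c hc htr hn hvt ht0
  have hut : 2 * t ≤ (NN G u).card + 1 := hvt.trans (by have := hmin u; omega)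
  have hdj : ∀ a b, G.Adj u a → G.Adj u b → ¬ MM G v a ⊆ MM G v b →
      ¬ MM G v b ⊆ MM G v a → Disjoint (MM G v b) (MM G v a) := by
    intro a b ha hb h1 h2
    by_contra hd
    rw [Finset.not_disjoint_iff] at hd
    obtain ⟨p, hp, hp'⟩ := hd
    rcases hn v u a b p huv ha hb hp' hp with h | h
    · exact h1 h
    · exact h2 h
  have hlt : ∀ a b, (MM G v a).card ≤ (MM G v b).card → ¬ MM G v a ⊆ MM G v b →
      ¬ MM G v b ⊆ MM G v a := by
    intro a b hle h1 h2
    exact h1 (by rw [Finset.eq_of_subset_of_card_le h2 hle])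
  obtain ⟨y1, hy1, hmax1⟩ := Finset.exists_max_image (NN G u) (fun z => (MM G v z).card)
    ⟨v, mem_NN.2 huv.symm⟩
  simp only [mem_NN] at hy1 hmax1
  by_cases hall1 : ∀ y, G.Adj u y → MM G v y ⊆ MM G v y1
  · exact step_two hut (hu y1 hy1) (hu y1 hy1) (fun y hy => Or.inl (hall1 y hy))
  push Not at hall1
  obtain ⟨y2', hy2', hs2'⟩ := hall1
  obtain ⟨y2, hy2, hmax2⟩ := Finset.exists_max_image
    ((NN G u).filter (fun z => ¬ MM G v z ⊆ MM G v y1)) (fun z => (MM G v z).card)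
    ⟨y2', Finset.mem_filter.2 ⟨mem_NN.2 hy2', hs2'⟩⟩
  simp only [Finset.mem_filter, mem_NN] at hy2 hmax2
  by_cases hall2 : ∀ y, G.Adj u y → MM G v y ⊆ MM G v y1 ∨ MM G v y ⊆ MM G v y2
  · exact step_two hut (hu y1 hy1) (hu y2 hy2.1) hall2
  push Not at hall2
  obtain ⟨y3, hy3, hs31, hs32⟩ := hall2
  have hne : ∀ a b, ¬ MM G v a ⊆ MM G v b → (MM G v a).Nonempty := by
    intro a b h
    rw [Finset.nonempty_iff_ne_empty]
    intro h'
    rw [h'] at h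
    simp at h
  have hs12 := hlt y2 y1 (hmax1 y2 hy2.1) hy2.2
  have hs13 := hlt y3 y1 (hmax1 y3 hy3) hs31
  have hs23 := hlt y3 y2 (hmax2 y3 ⟨hy3, hs31⟩) hs32
  exact step_three c hc hs hn hmin hvt (by omega) huv hy1 hy2.1 hy3 (hne _ _ hs12)
    (hne _ _ hy2.2) (hne _ _ hs31) (hdj _ _ hy2.1 hy1 hy2.2 hs12)
    (hdj _ _ hy3 hy1 hs31 hs13) (hdj _ _ hy3 hy2.1 hs32 hs23)

end Core

/-- Every bipartite fast finite simple graph `G` (on a nonempty vertex set)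
satisfies `δ(G) ≤ 2·ψ(G)`. -/
theorem fast_minDegree_le_two_psi {V : Type*} [Fintype V] [Nonempty V]
    (G : SimpleGraph V) [DecidableRel G.Adj]
    (hbip : IsBipartiteGraph G) (hfast : Fast G) :
    G.minDegree ≤ 2 * psi G := by
  classical
  obtain ⟨A, B, hAB, hdisj, hA, hB⟩ := hbip
  obtain ⟨-, hs, htr⟩ := hfast
  obtain ⟨v, hv⟩ := G.exists_minimal_degree_vertex
  have hNN : ∀ w, (NN G w).card = G.degree w := by
    intro w
    rw [← SimpleGraph.card_neighborFinset_eq_degree]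
    congr 1
    ext x
    simp [mem_NN]
  have hc : ∀ a b, G.Adj a b → (decide (a ∈ A)) ≠ (decide (b ∈ A)) := by
    intro a b hab h
    have hmem : ∀ x, x ∈ A ∨ x ∈ B := by
      intro x
      have : x ∈ A ∪ B := by rw [hAB]; trivial
      exact this
    rw [decide_eq_decide] at h
    by_cases ha : a ∈ A
    · exact hA ha (h.1 ha) hab
    · exact hB ((hmem a).resolve_left ha) ((hmem b).resolve_left (fun hb => ha (h.2 hb))) hab
  rcases Nat.eq_zero_or_pos G.minDegree with h0 | hpos
  · omega
  have hbic : Bic G ((G.minDegree + 1) / 2) := by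
    refine core (v := v) _ hc hs htr ?_ ?_ ?_
    · intro w
      rw [hNN, hNN, ← hv]
      exact G.minDegree_le_degree w
    · rw [hNN, ← hv]
      omega
    · omega
  have := hbic.le_psi
  omega
end

section
/- Every bipartite, hole-free, fast finite simple graph G with at least one edge satisfies pw(G) ≤ 2·ψ(G) − 1. -/
open SimpleGraph

/-- A path decomposition of a simple graph `G`: a nonempty finite sequence of bags
covering all vertices and edges, such that each vertex occurs in an interval of bags. -/
structure PathDecomp {V : Type*} (G : SimpleGraph V) where
  len : ℕ
  len_pos : 0 < len
  bags : Fin len → Finset V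
  mem_bag : ∀ v : V, ∃ i, v ∈ bags i
  edge_bag : ∀ ⦃u v : V⦄, G.Adj u v → ∃ i, u ∈ bags i ∧ v ∈ bags i
  interval : ∀ (v : V) (i j k : Fin len), i ≤ j → j ≤ k →
    v ∈ bags i → v ∈ bags k → v ∈ bags j

/-- The width of a path decomposition: maximum bag size minus one. -/
def PathDecomp.width {V : Type*} {G : SimpleGraph V} (D : PathDecomp G) : ℕ :=
  (Finset.univ.sup fun i => (D.bags i).card) - 1

/-- The pathwidth of a graph: minimum width over all path decompositions. -/
noncomputable def pathwidth {V : Type*} (G : SimpleGraph V) : ℕ :=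
  sInf {w : ℕ | ∃ D : PathDecomp G, D.width = w}

section Aux

variable {V : Type*} {G : SimpleGraph V}

lemma hasCopy_of_map {W : Type*} (H : SimpleGraph W)
    (htwin : ∀ i j : W, (∀ k, H.Adj i k ↔ H.Adj j k) → i = j)
    (f : W → V) (hf : ∀ i j, G.Adj (f i) (f j) ↔ H.Adj i j) : HasInducedCopy G H := by
  have hinj : Function.Injective f := by
    intro i j hij
    apply htwin
    intro k
    rw [← hf, ← hf, hij]
  refine ⟨Set.range f, ⟨?_⟩⟩
  refine RelIso.symm ⟨Equiv.ofInjective f hinj, ?_⟩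
  intro a b
  simpa using hf a b

instance : DecidableRel armchair.Adj := by unfold armchair; infer_instance

instance : DecidableRel stirrer.Adj := by unfold stirrer; infer_instance

instance : DecidableRel tripod.Adj := by unfold tripod; infer_instance

lemma armchair_false (h : ¬ HasInducedCopy G armchair) (s : V → Bool)
    (hs : ∀ u w, G.Adj u w → s w = !s u) (c1 c2 c3 c4 p1 p2 p3 : V)
    (e1 : G.Adj c1 c2) (e2 : G.Adj c2 c3) (e3 : G.Adj c3 c4) (e4 : G.Adj c4 c1)
    (e5 : G.Adj c1 p1) (e6 : G.Adj c2 p2) (e7 : G.Adj c3 p3)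
    (n1 : ¬ G.Adj c1 p3) (n2 : ¬ G.Adj c3 p1) (n3 : ¬ G.Adj p2 c4) (n4 : ¬ G.Adj p2 p1)
    (n5 : ¬ G.Adj p2 p3) : False := by
  apply h
  refine hasCopy_of_map _ ?_ ![c1, c2, c3, c4, p1, p2, p3] ?_
  · decide
  · have hs' : ∀ u w, s u = s w → ¬ G.Adj u w := fun u w h1 h2 => by
      have := hs u w h2; rw [h1] at this; simp at this
    have f1 := hs _ _ e1
    have f2 := hs _ _ e2
    have f3 := hs _ _ e3
    have f4 := hs _ _ e5
    have f5 := hs _ _ e6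
    have f6 := hs _ _ e7
    intro i j
    fin_cases i <;> fin_cases j <;>
      simp [armchair, SimpleGraph.fromRel_adj, e1, e2, e3, e4, e5, e6, e7, e1.symm, e2.symm,
        e3.symm, e4.symm, e5.symm, e6.symm, e7.symm, n1, n2, n3, n4, n5,
        G.adj_comm p3 c1, G.adj_comm p1 c3, G.adj_comm c4 p2, G.adj_comm p1 p2,
        G.adj_comm p3 p2] <;>
      (apply hs'; simp only [f1, f2, f3, f4, f5, f6, Bool.not_not])

lemma stirrer_false (h : ¬ HasInducedCopy G stirrer) (s : V → Bool)
    (hs : ∀ u w, G.Adj u w → s w = !s u) (v0 v1 v2 v3 v4 v5 v6 : V)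
    (e1 : G.Adj v0 v1) (e2 : G.Adj v1 v2) (e3 : G.Adj v2 v3) (e4 : G.Adj v3 v0)
    (e5 : G.Adj v1 v4) (e6 : G.Adj v4 v5) (e7 : G.Adj v5 v0) (e8 : G.Adj v0 v6)
    (n1 : ¬ G.Adj v2 v5) (n2 : ¬ G.Adj v2 v6) (n3 : ¬ G.Adj v4 v3) (n4 : ¬ G.Adj v4 v6) :
    False := by
  apply h
  refine hasCopy_of_map _ ?_ ![v0, v1, v2, v3, v4, v5, v6] ?_
  · decide
  · have hs' : ∀ u w, s u = s w → ¬ G.Adj u w := fun u w h1 h2 => by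
      have := hs u w h2; rw [h1] at this; simp at this
    have f1 := hs _ _ e1
    have f2 := hs _ _ e2
    have f3 := hs _ _ e3
    have f4 := hs _ _ e5
    have f5 := hs _ _ e6
    have f6 := hs _ _ e8
    intro i j
    fin_cases i <;> fin_cases j <;>
      simp [stirrer, SimpleGraph.fromRel_adj, e1, e2, e3, e4, e5, e6, e7, e8, e1.symm, e2.symm,
        e3.symm, e4.symm, e5.symm, e6.symm, e7.symm, e8.symm, n1, n2, n3, n4,
        G.adj_comm v5 v2, G.adj_comm v6 v2, G.adj_comm v3 v4, G.adj_comm v6 v4] <;>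
      (apply hs'; simp only [f1, f2, f3, f4, f5, f6, Bool.not_not])

lemma tripod_false (h : ¬ HasInducedCopy G tripod) (s : V → Bool)
    (hs : ∀ u w, G.Adj u w → s w = !s u) (v0 v1 v2 v3 v4 v5 v6 : V)
    (e1 : G.Adj v0 v1) (e2 : G.Adj v1 v2) (e3 : G.Adj v0 v3) (e4 : G.Adj v3 v4)
    (e5 : G.Adj v0 v5) (e6 : G.Adj v5 v6)
    (n1 : ¬ G.Adj v2 v3) (n2 : ¬ G.Adj v2 v5) (n3 : ¬ G.Adj v4 v1) (n4 : ¬ G.Adj v4 v5)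
    (n5 : ¬ G.Adj v6 v1) (n6 : ¬ G.Adj v6 v3) :
    False := by
  apply h
  refine hasCopy_of_map _ ?_ ![v0, v1, v2, v3, v4, v5, v6] ?_
  · decide
  · have hs' : ∀ u w, s u = s w → ¬ G.Adj u w := fun u w h1 h2 => by
      have := hs u w h2; rw [h1] at this; simp at this
    have f1 := hs _ _ e1
    have f2 := hs _ _ e2
    have f3 := hs _ _ e3
    have f4 := hs _ _ e4
    have f5 := hs _ _ e5
    have f6 := hs _ _ e6
    intro i j
    fin_cases i <;> fin_cases j <;>
      simp [tripod, SimpleGraph.fromRel_adj, e1, e2, e3, e4, e5, e6, e1.symm, e2.symm,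
        e3.symm, e4.symm, e5.symm, e6.symm, n1, n2, n3, n4, n5, n6,
        G.adj_comm v3 v2, G.adj_comm v5 v2, G.adj_comm v1 v4, G.adj_comm v5 v4,
        G.adj_comm v1 v6, G.adj_comm v3 v6] <;>
      (apply hs'; simp only [f1, f2, f3, f4, f5, f6, Bool.not_not])

lemma cycle_adj_iff (n : ℕ) (i j : Fin (n + 3)) :
    (SimpleGraph.cycleGraph (n + 3)).Adj i j ↔
      (i.val + 1 = j.val ∨ j.val + 1 = i.val ∨ (i.val = 0 ∧ j.val = n + 2) ∨
        (j.val = 0 ∧ i.val = n + 2)) := by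
  rw [SimpleGraph.cycleGraph_adj']
  rcases i with ⟨i, hi⟩
  rcases j with ⟨j, hj⟩
  simp only [Fin.sub_def]
  have key : ∀ a b : ℕ, a < n + 3 → b < n + 3 →
      ((n + 3 - b + a) % (n + 3) = 1 ↔ (b + 1 = a ∨ (a = 0 ∧ b = n + 2))) := by
    intro a b ha hb
    by_cases h : b ≤ a
    · have : n + 3 - b + a = (a - b) + (n + 3) := by omega
      rw [this, Nat.add_mod_right, Nat.mod_eq_of_lt (by omega)]
      omega
    · rw [Nat.mod_eq_of_lt (by omega)]
      omega
  rw [key i j hi hj, key j i hj hi]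
  omega

/-- An induced path closed up by a vertex is a hole. -/
lemma hole_false (h : HoleFree G) (k : ℕ) (hk : 3 ≤ k) (q : ℕ → V) (p : V)
    (hq : ∀ i < k, G.Adj (q i) (q (i + 1)))
    (hind : ∀ i j, i < j → j ≤ k → G.Adj (q i) (q j) → j = i + 1)
    (h0 : G.Adj p (q 0)) (h1 : G.Adj p (q k))
    (h2 : ∀ i, 0 < i → i < k → ¬ G.Adj p (q i)) : False := by
  obtain ⟨n, rfl⟩ : ∃ n, k = n + 1 := ⟨k - 1, by omega⟩
  apply h (n + 3) (by omega)
  refine hasCopy_of_map _ ?_ (fun i => if i.val ≤ n + 1 then q i.val else p) ?_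
  · intro i j hij
    by_contra hne
    have hne' : i.val ≠ j.val := fun hh => hne (Fin.ext hh)
    have hi := i.isLt
    have hj := j.isLt
    have H : ∀ m (hm : m < n + 3), (SimpleGraph.cycleGraph (n + 3)).Adj i ⟨m, hm⟩ ↔
      (SimpleGraph.cycleGraph (n + 3)).Adj j ⟨m, hm⟩ := fun m hm => hij ⟨m, hm⟩
    simp only [cycle_adj_iff] at H
    have a1 := H (i.val + 1)
    have a2 := H (i.val - 1) (by omega)
    have a3 := H 0 (by omega)
    have a4 := H (n + 2) (by omega)
    omega
  · intro i j
    rw [cycle_adj_iff]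
    have hi := i.isLt
    have hj := j.isLt
    have hpath : ∀ a b, a ≤ n + 1 → b ≤ n + 1 →
        (G.Adj (q a) (q b) ↔ (a + 1 = b ∨ b + 1 = a)) := by
      intro a b ha hb
      constructor
      · intro hab
        rcases lt_trichotomy a b with hlt | heq | hlt
        · left; exact (hind a b hlt hb hab).symm
        · subst heq; exact absurd hab (G.irrefl)
        · right; exact (hind b a hlt ha hab.symm).symm
      · rintro (rfl | rfl)
        · exact hq a (by omega)
        · exact (hq b (by omega)).symm
    have hp : ∀ a, a ≤ n + 1 → (G.Adj p (q a) ↔ (a = 0 ∨ a = n + 1)) := by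
      intro a ha
      constructor
      · intro hab
        by_contra hh
        exact h2 a (by omega) (by omega) hab
      · rintro (rfl | rfl)
        · exact h0
        · exact h1
    by_cases c1 : i.val ≤ n + 1 <;> by_cases c2 : j.val ≤ n + 1
    · rw [if_pos c1, if_pos c2, hpath _ _ c1 c2]; omega
    · rw [if_pos c1, if_neg c2, G.adj_comm, hp _ c1]; omega
    · rw [if_neg c1, if_pos c2, hp _ c2]; omega
    · rw [if_neg c1, if_neg c2]
      constructor
      · intro hh; exact absurd hh G.irrefl
      · intro hh; omega

end Aux

section Aux2

variable {V : Type*} {G : SimpleGraph V}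

/-- A walk of length `k` inside `C`. -/
def IsChain' (G : SimpleGraph V) (C : Finset V) (k : ℕ) (q : ℕ → V) : Prop :=
  (∀ i ≤ k, q i ∈ C) ∧ ∀ i < k, G.Adj (q i) (q (i + 1))

/-- `C` is connected. -/
def ConnIn (G : SimpleGraph V) (C : Finset V) : Prop :=
  ∀ x ∈ C, ∀ y ∈ C, Relation.ReflTransGen (fun a b => G.Adj a b ∧ a ∈ C ∧ b ∈ C) x y

lemma ConnIn.exists_chain {C : Finset V} (h : ConnIn G C) {x y : V} (hx : x ∈ C) (hy : y ∈ C) :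
    ∃ k q, IsChain' G C k q ∧ q 0 = x ∧ q k = y := by
  have := h x hx y hy
  clear hy
  induction this with
  | refl => exact ⟨0, fun _ => x, ⟨fun _ _ => hx, fun i hi => by omega⟩, rfl, rfl⟩
  | @tail b c _ hbc ih =>
    obtain ⟨k, q, ⟨h1, h2⟩, h3, h4⟩ := ih
    refine ⟨k + 1, fun i => if i ≤ k then q i else c, ⟨?_, ?_⟩, by simp [h3], by simp⟩
    · intro i hi
      try dsimp only
      split_ifs with hh
      · exact h1 i hh
      · exact hbc.2.2
    · intro i hi
      try dsimp only
      rw [if_pos (by omega)]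
      split_ifs with hh
      · exact h2 i (by omega)
      · have : i = k := by omega
        subst this
        rw [h4]; exact hbc.1

lemma IsChain'.sub {C : Finset V} {k : ℕ} {q : ℕ → V} (h : IsChain' G C k q) (i j : ℕ)
    (hij : i ≤ j) (hj : j ≤ k) : IsChain' G C (j - i) (fun t => q (i + t)) :=
  ⟨fun t ht => h.1 _ (by omega), fun t ht => h.2 (i + t) (by omega)⟩

/-- A shortest chain between endpoints satisfying a property is an induced path. -/
lemma exists_min_chain {C : Finset V} (P : V → V → Prop)
    (hex : ∃ k q, IsChain' G C k q ∧ P (q 0) (q k)) :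
    ∃ k q, IsChain' G C k q ∧ P (q 0) (q k) ∧
      (∀ i j, i < j → j ≤ k → G.Adj (q i) (q j) → j = i + 1) ∧
      (∀ i j, i ≤ j → j ≤ k → j - i < k → ¬ P (q i) (q j)) := by
  classical
  let k := Nat.find hex
  obtain ⟨q, hq, hP⟩ := Nat.find_spec hex
  have hmin : ∀ k' < k, ∀ q', IsChain' G C k' q' → ¬ P (q' 0) (q' k') := by
    intro k' hk' q' h1 h2
    exact Nat.find_min hex hk' ⟨q', h1, h2⟩
  change IsChain' G C k q at hq
  change P (q 0) (q k) at hP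
  refine ⟨k, q, hq, hP, ?_, ?_⟩
  · intro i j hij hj hadj
    by_contra hne
    refine hmin (k - (j - i - 1)) (by omega)
      (fun t => if t ≤ i then q t else q (t + (j - i - 1))) ⟨?_, ?_⟩ ?_
    · intro t ht
      try dsimp only
      split_ifs
      · exact hq.1 _ (by omega)
      · exact hq.1 _ (by omega)
    · intro t ht
      try dsimp only
      split_ifs with a b b
      · exact hq.2 _ (by omega)
      · have : t = i := by omega
        subst this
        rw [show t + 1 + (j - t - 1) = j by omega]
        exact hadj
      · omega
      · rw [show t + 1 + (j - i - 1) = t + (j - i - 1) + 1 by omega]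
        exact hq.2 _ (by omega)
    · try dsimp only
      rw [if_pos (by omega), if_neg (by omega), show k - (j - i - 1) + (j - i - 1) = k by omega]
      exact hP
  · intro i j hij hj hlt hPij
    have := hmin (j - i) hlt _ (hq.sub i j hij hj)
    simp only [Nat.add_zero] at this
    rw [show i + (j - i) = j by omega] at this
    exact this hPij

lemma chain_side {s : V → Bool} (hs : ∀ u w, G.Adj u w → s w = !s u) {C : Finset V} {k : ℕ}
    {q : ℕ → V} (h : IsChain' G C k q) :
    ∀ i ≤ k, s (q i) = if i % 2 = 0 then s (q 0) else !s (q 0) := by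
  intro i
  induction i with
  | zero => simp
  | succ n ih =>
    intro hn
    rw [hs _ _ (h.2 n (by omega)), ih (by omega)]
    rcases Nat.mod_two_eq_zero_or_one n with h0 | h0
    · rw [if_pos h0, if_neg (by omega)]
    · rw [if_neg (by omega), if_pos (by omega), Bool.not_not]

lemma not_adj_side {s : V → Bool} (hs : ∀ u w, G.Adj u w → s w = !s u) {u w : V}
    (h : s u = s w) : ¬ G.Adj u w := by
  intro h2
  have := hs u w h2
  rw [h] at this
  simp at this

lemma E1_path (hhole : HoleFree G) (hfast : Fast G) {s : V → Bool}
    (hs : ∀ u w, G.Adj u w → s w = !s u) {C : Finset V} (hC : ConnIn G C) {v : V}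
    (hv : ∀ x ∈ C, ¬ G.Adj v x) {u u' z z' : V} (hu : G.Adj v u) (hu' : G.Adj v u')
    (hz : z ∈ C) (hz' : z' ∈ C) (huz : G.Adj u z) (huz' : G.Adj u' z')
    (n1 : ¬ G.Adj u z') (n2 : ¬ G.Adj u' z) : False := by
  obtain ⟨k, q, hq, ⟨⟨a1, a2⟩, a3, a4⟩, hind, hmin⟩ := exists_min_chain (G := G) (C := C)
    (fun x y => (G.Adj u x ∧ ¬ G.Adj u' x) ∧ (G.Adj u' y ∧ ¬ G.Adj u y)) (by
      obtain ⟨k, q, h, h0, h1⟩ := hC.exists_chain hz hz'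
      refine ⟨k, q, h, ?_⟩
      rw [h0, h1]
      exact ⟨⟨huz, n2⟩, huz', n1⟩)
  clear huz huz' n1 n2 hz hz'
  have su := hs _ _ hu
  have su' := hs _ _ hu'
  have s0 := hs _ _ a1
  have sk := hs _ _ a3
  have hside := chain_side hs hq
  have hpar : ∀ i ≤ k, (G.Adj u (q i) ∨ G.Adj u' (q i)) → i % 2 = 0 := by
    intro i hi h
    by_contra hodd
    have h3 := hside i hi
    rw [if_neg hodd] at h3
    rcases h with h | h
    · have := hs _ _ h
      rw [h3, s0] at this; simp at this
    · have := hs _ _ h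
      rw [h3, s0, su, su'] at this; simp at this
  have hk2 := hpar k le_rfl (Or.inr a3)
  have hk0 : k ≠ 0 := by
    rintro rfl; exact a2 a3
  have hboth : ∀ i, 0 < i → i < k → (G.Adj u (q i) ↔ G.Adj u' (q i)) := by
    intro i h0 h1
    constructor
    · intro h
      by_contra hh
      exact hmin i k (by omega) le_rfl (by omega) ⟨⟨h, hh⟩, a3, a4⟩
    · intro h
      by_contra hh
      exact hmin 0 i (by omega) (by omega) (by omega) ⟨⟨a1, a2⟩, h, hh⟩
  have hind' : ∀ i j, i ≤ k → j ≤ k → G.Adj (q i) (q j) → (j = i + 1 ∨ i = j + 1) := by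
    intro i j hi hj h
    rcases lt_trichotomy i j with hlt | heq | hlt
    · left; exact hind i j hlt hj h
    · subst heq; exact absurd h G.irrefl
    · right; exact hind j i hlt hi h.symm
  by_cases hex : ∃ j, 0 < j ∧ j < k ∧ G.Adj u (q j)
  · obtain ⟨j, h0, h1, hj⟩ := hex
    have hj' := (hboth j h0 h1).1 hj
    have hj2 := hpar j h1.le (Or.inl hj)
    by_cases c1 : j + 1 = k - 1
    · by_cases c2 : j = 2
      · have hk4 : k = 4 := by omega
        subst c2 hk4
        refine stirrer_false hfast.2.1 s hs (q 2) u (q 0) (q 1) v u' (q 3) hj.symm a1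
          (hq.2 0 (by omega)) (hq.2 1 (by omega)) hu.symm hu' hj' (hq.2 2 (by omega))
          (fun h => a2 h.symm) ?_ (hv _ (hq.1 _ (by omega))) (hv _ (hq.1 _ (by omega)))
        intro h
        have := hind' 0 3 (by omega) (by omega) h
        omega
      · have e : G.Adj (q (j - 1)) (q j) := by
          have := hq.2 (j - 1) (by omega)
          rwa [show j - 1 + 1 = j by omega] at this
        refine armchair_false hfast.1 s hs u (q j) u' v (q 0) (q (j - 1)) (q k) hj hj'.symm
          hu'.symm hu a1 e.symm a3 a4 a2 (fun h => hv _ (hq.1 _ (by omega)) h.symm) ?_ ?_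
        · intro h; have := hind' _ _ (by omega) (by omega) h; omega
        · intro h; have := hind' _ _ (by omega) (by omega) h; omega
    · refine armchair_false hfast.1 s hs u (q j) u' v (q 0) (q (j + 1)) (q k) hj hj'.symm
          hu'.symm hu a1 (hq.2 j h1) a3 a4 a2 (fun h => hv _ (hq.1 _ (by omega)) h.symm) ?_ ?_
      · intro h; have := hind' _ _ (by omega) (by omega) h; omega
      · intro h; have := hind' _ _ (by omega) (by omega) h; omega
  · push Not at hex
    have hex' : ∀ j, 0 < j → j < k → ¬ G.Adj u' (q j) := fun j h0 h1 h =>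
      hex j h0 h1 ((hboth j h0 h1).2 h)
    refine hole_false hhole (k + 2) (by omega)
      (fun i => if i = 0 then u else if i ≤ k + 1 then q (i - 1) else u') v ?_ ?_ ?_ ?_ ?_
    · intro i hi
      try dsimp only
      by_cases c : i = 0
      · subst c; simpa using a1
      · by_cases c' : i = k + 1
        · subst c'
          simpa using a3.symm
        · rw [if_neg c, if_pos (by omega), if_neg (by omega), if_pos (by omega)]
          have := hq.2 (i - 1) (by omega)
          rwa [show i - 1 + 1 = i + 1 - 1 by omega] at this
    · intro i j hij hj
      try dsimp only
      rw [if_neg (show ¬ j = 0 by omega)]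
      by_cases c : i = 0
      · rw [if_pos c]
        split_ifs with d
        · intro h
          by_contra hne
          by_cases d' : j = k + 1
          · subst d'; exact a4 (by simpa using h)
          · exact hex (j - 1) (by omega) (by omega) h
        · intro h
          exact absurd h (not_adj_side hs (by rw [su, su']))
      · rw [if_neg c, if_pos (by omega)]
        split_ifs with d
        · intro h
          have := hind (i - 1) (j - 1) (by omega) (by omega) h
          omega
        · intro h
          by_contra hne
          by_cases d' : i = 1
          · subst d'; exact a2 (by simpa using h.symm)
          · exact hex' (i - 1) (by omega) (by omega) h.symm
    · simpa using hu
    · simpa using hu'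
    · intro i h0 h1
      try dsimp only
      rw [if_neg (by omega), if_pos (by omega)]
      exact hv _ (hq.1 _ (by omega))

lemma E2_path (hhole : HoleFree G) (hfast : Fast G) {s : V → Bool}
    (hs : ∀ u w, G.Adj u w → s w = !s u) {C : Finset V} (hC : ConnIn G C) {v : V}
    (hv : ∀ x ∈ C, ¬ G.Adj v x) {p x x' u u' : V} (hp : G.Adj v p)
    (hx : G.Adj p x) (hx' : G.Adj p x') (mx : x ∈ C) (mx' : x' ∈ C)
    (mu : u ∈ C) (mu' : u' ∈ C) (hxu : G.Adj x u) (hxu' : G.Adj x' u')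
    (n1 : ¬ G.Adj x u') (n2 : ¬ G.Adj x' u) : False := by
  obtain ⟨k, q, hq, ⟨a1, a2, ⟨u, mu, a3, a4⟩, ⟨u', mu', a5, a6⟩⟩, hind, hmin⟩ :=
    exists_min_chain (G := G) (C := C)
    (fun x y => G.Adj p x ∧ G.Adj p y ∧ (∃ u ∈ C, G.Adj x u ∧ ¬ G.Adj y u) ∧
      (∃ u' ∈ C, G.Adj y u' ∧ ¬ G.Adj x u')) (by
      obtain ⟨k, q, h, h0, h1⟩ := hC.exists_chain mx mx'
      refine ⟨k, q, h, ?_⟩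
      rw [h0, h1]
      exact ⟨hx, hx', ⟨u, mu, hxu, n2⟩, ⟨u', mu', hxu', n1⟩⟩)
  clear hx hx' mx mx' hxu hxu' n1 n2
  have s0 := hs _ _ a1
  have sk := hs _ _ a2
  have hside := chain_side hs hq
  have hpar : ∀ i ≤ k, G.Adj p (q i) → i % 2 = 0 := by
    intro i hi h
    by_contra hodd
    have h3 := hside i hi
    rw [if_neg hodd] at h3
    have := hs _ _ h
    rw [h3, s0] at this; simp at this
  have hk2 := hpar k le_rfl a2
  have hk0 : k ≠ 0 := by
    rintro rfl; exact a4 a3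
  have hind' : ∀ i j, i ≤ k → j ≤ k → G.Adj (q i) (q j) → (j = i + 1 ∨ i = j + 1) := by
    intro i j hi hj h
    rcases lt_trichotomy i j with hlt | heq | hlt
    · left; exact hind i j hlt hj h
    · subst heq; exact absurd h G.irrefl
    · right; exact hind j i hlt hi h.symm
  have hpred : ∀ i, 0 < i → i ≤ k → G.Adj (q i) (q (i - 1)) := by
    intro i h0 h1
    have := hq.2 (i - 1) (by omega)
    rw [show i - 1 + 1 = i by omega] at this
    exact this.symm
  by_cases hk : k = 2
  · subst hk
    exact armchair_false hfast.1 s hs (q 0) p (q 2) (q 1) u v u' a1.symm a2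
      (hpred 2 (by omega) le_rfl) (hpred 1 (by omega) (by omega)) a3 hp.symm a5 a6 a4
      (hv _ (hq.1 _ (by omega))) (hv _ mu) (hv _ mu')
  by_cases hex : ∃ j, 0 < j ∧ j < k ∧ G.Adj p (q j)
  · obtain ⟨j, h0, h1, hj⟩ := hex
    have hj2 := hpar j h1.le hj
    have m1 := hmin 0 j (by omega) (by omega) (by omega)
    have m2 := hmin j k (by omega) (by omega) (by omega)
    have hN : ∀ i ≤ k, ∀ l ≤ k, l ≠ i + 1 → i ≠ l + 1 → ¬ G.Adj (q i) (q l) := by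
      intro i hi l hl h3 h4 h
      rcases hind' i l hi hl h with h | h <;> omega
    have cj : j = 2 := by
      by_contra hne
      exact m1 ⟨a1, hj, ⟨q 1, hq.1 _ (by omega), hq.2 0 (by omega),
        hN _ (by omega) _ (by omega) (by omega) (by omega)⟩,
        ⟨q (j - 1), hq.1 _ (by omega), hpred _ h0 h1.le,
        hN _ (by omega) _ (by omega) (by omega) (by omega)⟩⟩
    have ck : k = j + 2 := by
      by_contra hne
      exact m2 ⟨hj, a2, ⟨q (j + 1), hq.1 _ (by omega), hq.2 j (by omega),
        hN _ (by omega) _ (by omega) (by omega) (by omega)⟩,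
        ⟨q (k - 1), hq.1 _ (by omega), hpred _ (by omega) le_rfl,
        hN _ (by omega) _ (by omega) (by omega) (by omega)⟩⟩
    subst cj
    subst ck
    have b1 : G.Adj (q 2) u := by
      by_contra hne
      exact m1 ⟨a1, hj, ⟨u, mu, a3, hne⟩, ⟨q 3, hq.1 _ (by omega), hq.2 2 (by omega),
        hN _ (by omega) _ (by omega) (by omega) (by omega)⟩⟩
    have b2 : G.Adj (q 2) u' := by
      by_contra hne
      exact m2 ⟨hj, a2, ⟨q 1, hq.1 _ (by omega), hpred 2 (by omega) (by omega),
        hN _ (by omega) _ (by omega) (by omega) (by omega)⟩, ⟨u', mu', a5, hne⟩⟩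
    exact stirrer_false hfast.2.1 s hs p (q 2) u (q 0) u' (q (2 + 2)) v hj b1 a3.symm a1.symm
      b2 a5.symm a2.symm hp.symm (fun h => a4 h.symm) (fun h => hv _ mu h.symm)
      (fun h => a6 h.symm) (fun h => hv _ mu' h.symm)
  · push Not at hex
    exact hole_false hhole k (by omega) q p hq.2 hind a1 a2 hex

/-- The conditions making a vertex a valid left end of the layering. -/
structure GoodRoot (G : SimpleGraph V) (v : V) : Prop where
  e1 : ∀ u u' z z', G.Adj v u → G.Adj v u' → G.Adj u z → G.Adj u' z' → ¬ G.Adj u z' →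
    ¬ G.Adj u' z → False
  e2 : ∀ p x x' u u', G.Adj v p → G.Adj p x → G.Adj p x' → G.Adj x u → G.Adj x' u' →
    ¬ G.Adj x u' → ¬ G.Adj x' u → ¬ G.Adj v u → ¬ G.Adj v u' → False
  e3 : ∀ x u y u' w, G.Adj v x → G.Adj x u → G.Adj u y → G.Adj v y → G.Adj x u' → G.Adj u w →
    ¬ G.Adj v w → ¬ G.Adj u' y → (∀ t, G.Adj u' t → G.Adj v t) → False

lemma ConnIn.insert [DecidableEq V] {C : Finset V} (hC : ConnIn G C) {z c : V} (hc : c ∈ C)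
    (hz : G.Adj z c) : ConnIn G (insert z C) := by
  have hmono : ∀ x ∈ C, ∀ y ∈ C, Relation.ReflTransGen
      (fun a b => G.Adj a b ∧ a ∈ Insert.insert z C ∧ b ∈ Insert.insert z C) x y := by
    intro x hx y hy
    refine Relation.ReflTransGen.mono ?_ _ _ (hC x hx y hy)
    rintro a b ⟨h1, h2, h3⟩
    exact ⟨h1, Finset.mem_insert_of_mem h2, Finset.mem_insert_of_mem h3⟩
  have m1 : z ∈ Insert.insert z C := Finset.mem_insert_self _ _
  have m2 : c ∈ Insert.insert z C := Finset.mem_insert_of_mem hc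
  intro x hx y hy
  rcases Finset.mem_insert.1 hx with rfl | hx'
  · rcases Finset.mem_insert.1 hy with rfl | hy'
    · exact .refl
    · exact .head ⟨hz, m1, m2⟩ (hmono _ hc _ hy')
  · rcases Finset.mem_insert.1 hy with rfl | hy'
    · exact .tail (hmono _ hx' _ hc) ⟨hz.symm, m2, m1⟩
    · exact hmono _ hx' _ hy'

/-- `C` is a connected set avoiding the closed neighbourhood of `v`, inside its component. -/
def ValidAt (G : SimpleGraph V) (v : V) (C : Finset V) : Prop :=
  (∀ x ∈ C, x ≠ v ∧ ¬ G.Adj v x ∧ G.Reachable v x) ∧ ConnIn G C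

lemma goodRoot_of_max (hhole : HoleFree G) (hfast : Fast G) {s : V → Bool}
    (hs : ∀ u w, G.Adj u w → s w = !s u) {v : V} {C : Finset V} (hC : ValidAt G v C)
    (hmax : ∀ v' C', G.Reachable v v' → ValidAt G v' C' → C'.card ≤ C.card) :
    GoodRoot G v := by
  classical
  have hCv : ∀ x ∈ C, ¬ G.Adj v x := fun x hx => (hC.1 x hx).2.1
  have F1 : ∀ z, z ∉ C → z ≠ v → ¬ G.Adj v z → ∀ c ∈ C, ¬ G.Adj z c := by
    intro z hz hzv hn c hc hzc
    have := hmax v (insert z C) (SimpleGraph.Reachable.refl _) ⟨?_, hC.2.insert hc hzc⟩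
    · rw [Finset.card_insert_of_notMem hz] at this
      omega
    · intro x hx
      rcases Finset.mem_insert.1 hx with rfl | hx'
      · exact ⟨hzv, hn, (hC.1 c hc).2.2.trans hzc.symm.reachable⟩
      · exact hC.1 x hx'
  have F2 : ∀ z, z ≠ v → ¬ G.Adj v z → G.Reachable v z → C.Nonempty := by
    intro z h1 h2 h3
    have := hmax v {z} (SimpleGraph.Reachable.refl _) ⟨?_, ?_⟩
    · rw [Finset.card_singleton] at this
      exact Finset.card_pos.1 this
    · intro x hx
      rw [Finset.mem_singleton] at hx
      subst hx
      exact ⟨h1, h2, h3⟩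
    · intro x hx y hy
      rw [Finset.mem_singleton] at hx hy
      subst hx; subst hy
      exact .refl
  have F3 : C.Nonempty → ∃ y, G.Adj v y ∧ ∃ c ∈ C, G.Adj y c := by
    rintro ⟨c0, hc0⟩
    obtain ⟨p⟩ := (hC.1 c0 hc0).2.2.symm
    obtain ⟨d, -, hd1, hd2⟩ := p.exists_boundary_dart (C : Set V) (by simpa using hc0)
      (by intro h; exact (hC.1 v (by simpa using h)).1 rfl)
    simp only [Finset.mem_coe] at hd1 hd2
    refine ⟨d.snd, ?_, d.fst, hd1, d.adj.symm⟩
    by_contra hn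
    refine F1 d.snd hd2 ?_ hn d.fst hd1 d.adj.symm
    intro h
    have := d.adj.symm
    rw [h] at this
    exact hCv _ hd1 this
  have F4 : ∀ w, w ≠ v → ¬ G.Adj v w → w ∉ C → G.Reachable v w → ∀ y c, G.Adj v y → c ∈ C →
      G.Adj y c → G.Adj w y := by
    intro w h1 h2 h3 h4 y c hy hc hyc
    by_contra hwy
    have hyC : y ∉ C := fun h => hCv _ h hy
    have hvC : v ∉ insert y C := by
      intro h
      rcases Finset.mem_insert.1 h with h | h
      · subst h; exact G.irrefl hy
      · exact (hC.1 _ h).1 rfl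
    have := hmax w (insert v (insert y C)) h4 ⟨?_, ?_⟩
    · rw [Finset.card_insert_of_notMem hvC, Finset.card_insert_of_notMem hyC] at this
      omega
    · intro x hx
      rcases Finset.mem_insert.1 hx with rfl | hx'
      · exact ⟨h1.symm, fun h => h2 h.symm, h4.symm⟩
      · rcases Finset.mem_insert.1 hx' with rfl | hx''
        · exact ⟨fun h => h2 (h ▸ hy), hwy, h4.symm.trans hy.reachable⟩
        · exact ⟨fun h => h3 (h ▸ hx''), F1 w h3 h1 h2 x hx'', h4.symm.trans (hC.1 x hx'').2.2⟩
    · exact (hC.2.insert hc hyc).insert (Finset.mem_insert_self _ _) hy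
  have F5 : ∀ w, s w = !s v → ¬ G.Adj v w → G.Reachable v w → w ∈ C := by
    intro w h1 h2 h3
    by_contra h4
    have hne : w ≠ v := by
      rintro rfl; simp at h1
    obtain ⟨y, hy, c, hc, hyc⟩ := F3 (F2 w hne h2 h3)
    have := F4 w hne h2 h4 h3 y c hy hc hyc
    exact not_adj_side hs (by rw [h1, hs _ _ hy]) this
  have same : ∀ u z, G.Adj v u → G.Adj u z → ¬ G.Adj v z := by
    intro u z h1 h2
    exact not_adj_side hs (by rw [hs _ _ h2, hs _ _ h1, Bool.not_not])
  refine ⟨?_, ?_, ?_⟩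
  · intro u u' z z' hu hu' hz hz' n1 n2
    have zv : z ≠ v := by rintro rfl; exact n2 hu'.symm
    have zv' : z' ≠ v := by rintro rfl; exact n1 hu.symm
    have rz := hu.reachable.trans hz.reachable
    have rz' := hu'.reachable.trans hz'.reachable
    have nz := same _ _ hu hz
    have nz' := same _ _ hu' hz'
    by_cases c1 : z ∈ C
    · by_cases c2 : z' ∈ C
      · exact E1_path hhole hfast hs hC.2 hCv hu hu' c1 c2 hz hz' n1 n2
      · exact n1 (F4 z' zv' nz' c2 rz' u z hu c1 hz).symm
    · by_cases c2 : z' ∈ C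
      · exact n2 (F4 z zv nz c1 rz u' z' hu' c2 hz').symm
      · obtain ⟨y, hy, c, hc, hyc⟩ := F3 (F2 z zv nz rz)
        have b1 := F4 z zv nz c1 rz y c hy hc hyc
        have b2 := F4 z' zv' nz' c2 rz' y c hy hc hyc
        exact stirrer_false hfast.2.1 s hs y v u z u' z' c hy.symm hu hz b1 hu' hz' b2 hyc n1
          (fun h => n1 (F4 z' zv' nz' c2 rz' u c hu hc h).symm) n2
          (fun h => n2 (F4 z zv nz c1 rz u' c hu' hc h).symm)
  · intro p x x' u u' hp hx hx' hu hu' n1 n2 m1 m2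
    have sx : ∀ a b, G.Adj p a → G.Adj a b → s b = !s v := by
      intro a b h1 h2
      rw [hs _ _ h2, hs _ _ h1, hs _ _ hp, Bool.not_not]
    have uC := F5 u (sx _ _ hx hu) m1 ((hp.reachable.trans hx.reachable).trans hu.reachable)
    have uC' := F5 u' (sx _ _ hx' hu') m2
      ((hp.reachable.trans hx'.reachable).trans hu'.reachable)
    have xC : x ∈ C := by
      by_contra h
      exact F1 x h (by rintro rfl; exact m1 hu) (same _ _ hp hx) u uC hu
    have xC' : x' ∈ C := by
      by_contra h
      exact F1 x' h (by rintro rfl; exact m2 hu') (same _ _ hp hx') u' uC' hu'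
    exact E2_path hhole hfast hs hC.2 hCv hp hx hx' xC xC' uC uC' hu hu' n1 n2
  · intro x u y u' w hx hxu huy hy hxu' hw n1 n2 hall
    have wC := F5 w (by rw [hs _ _ hw, hs _ _ hxu, hs _ _ hx, Bool.not_not]) n1
      ((hx.reachable.trans hxu.reachable).trans hw.reachable)
    have uC : u ∈ C := by
      by_contra h
      exact F1 u h (by rintro rfl; exact n1 hw) (same _ _ hx hxu) w wC hw
    have u'v : u' ≠ v := by rintro rfl; exact n2 hy
    have u'C : u' ∉ C := by
      intro h
      have hne : u' ≠ u := by rintro rfl; exact n2 huy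
      rcases Relation.ReflTransGen.cases_head (hC.2 u' h u uC) with h1 | ⟨t, ht, -⟩
      · exact hne h1
      · exact hCv t ht.2.2 (hall t ht.1)
    exact n2 (F4 u' u'v (same _ _ hx hxu') u'C (hx.reachable.trans hxu'.reachable) y u hy uC
      huy.symm)

lemma exists_goodRoot [Fintype V] (hhole : HoleFree G) (hfast : Fast G) {s : V → Bool}
    (hs : ∀ u w, G.Adj u w → s w = !s u) (v0 : V) : ∃ v, G.Reachable v0 v ∧ GoodRoot G v := by
  classical
  let S : Finset (V × Finset V) :=
    Finset.univ.filter (fun p => G.Reachable v0 p.1 ∧ ValidAt G p.1 p.2)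
  have hS : S.Nonempty := by
    refine ⟨(v0, ∅), ?_⟩
    simp only [S, Finset.mem_filter, Finset.mem_univ, true_and]
    exact ⟨SimpleGraph.Reachable.refl _, by simp, fun x hx => by simp at hx⟩
  obtain ⟨⟨v, C⟩, hm, hmax⟩ := Finset.exists_max_image S (fun p => p.2.card) hS
  simp only [S, Finset.mem_filter, Finset.mem_univ, true_and] at hm hmax
  refine ⟨v, hm.1, goodRoot_of_max hhole hfast hs hm.2 ?_⟩
  intro v' C' h1 h2
  exact hmax (v', C') ⟨hm.1.trans h1, h2⟩

end Aux2

section Aux3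

variable {V : Type*} {G : SimpleGraph V}

/-- A layering of the graph: `c` is the component, `d` the distance to a good root of it. -/
structure Layering (G : SimpleGraph V) (s : V → Bool) (c : V → ℕ) (d : V → ℕ) : Prop where
  comp : ∀ u w, G.Adj u w → c u = c w
  root : ∀ u w, c u = c w → d u = 0 → d w = 0 → u = w
  step : ∀ u w, G.Adj u w → (d w = d u + 1 ∨ d u = d w + 1)
  back : ∀ u n, d u = n + 1 → ∃ w, G.Adj u w ∧ d w = n
  good : ∀ u, d u = 0 → GoodRoot G u
  par : ∀ u w, c u = c w → s u = s w → d u % 2 = d w % 2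

variable {s : V → Bool} {c d : V → ℕ}

lemma Layering.nadj (L : Layering G s c d) {u w : V} (h1 : d w ≠ d u + 1) (h2 : d u ≠ d w + 1) :
    ¬ G.Adj u w := by
  intro h
  have := L.step u w h
  omega

lemma Layering.nested (L : Layering G s c d) (hfast : Fast G)
    (hs : ∀ u w, G.Adj u w → s w = !s u) :
    ∀ i, ∀ x x' u u', c x = c x' → d x = i → d x' = i → d u = i + 1 → d u' = i + 1 →
      G.Adj x u → G.Adj x' u' → ¬ G.Adj x u' → ¬ G.Adj x' u → False := by
  intro i
  induction i with
  | zero =>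
    intro x x' u u' hc h1 h2 h3 h4 e1 e2 n1 n2
    have := L.root x x' hc h1 h2
    subst this
    exact n1 e2
  | succ i ih =>
    intro x x' u u' hc h1 h2 h3 h4 e1 e2 n1 n2
    obtain ⟨p, hpx, hpx', hp⟩ : ∃ p, G.Adj p x ∧ G.Adj p x' ∧ d p = i := by
      obtain ⟨p1, a1, b1⟩ := L.back x i h1
      obtain ⟨p2, a2, b2⟩ := L.back x' i h2
      by_cases g1 : G.Adj p1 x'
      · exact ⟨p1, a1.symm, g1, b1⟩
      by_cases g2 : G.Adj p2 x
      · exact ⟨p2, g2, a2.symm, b2⟩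
      have := L.comp _ _ a1
      have := L.comp _ _ a2
      exact (ih p1 p2 x x' (by omega) b1 b2 h1 h2 a1.symm a2.symm g1 g2).elim
    rcases Nat.eq_zero_or_pos i with h0 | h0
    · subst h0
      exact (L.good p hp).e1 x x' u u' hpx hpx' e1 e2 n1 n2
    · obtain ⟨q, hq, hdq⟩ := L.back p (i - 1) (by omega)
      by_cases h1' : i = 1
      · subst h1'
        exact (L.good q hdq).e2 p x x' u u' hq.symm hpx hpx' e1 e2 n1 n2
          (L.nadj (by omega) (by omega)) (L.nadj (by omega) (by omega))
      · obtain ⟨r, hr, hdr⟩ := L.back q (i - 2) (by omega)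
        exact tripod_false hfast.2.2 s hs p x u x' u' q r hpx e1 hpx' e2 hq hr
          (fun h => n2 h.symm) (L.nadj (by omega) (by omega)) (fun h => n1 h.symm)
          (L.nadj (by omega) (by omega)) (L.nadj (by omega) (by omega))
          (L.nadj (by omega) (by omega))

lemma Layering.common (L : Layering G s c d) (hfast : Fast G)
    (hs : ∀ u w, G.Adj u w → s w = !s u) (x x' : V) (i : ℕ) (hc : c x = c x')
    (h1 : d x = i + 1) (h2 : d x' = i + 1) : ∃ p, G.Adj p x ∧ G.Adj p x' ∧ d p = i := by
  obtain ⟨p1, a1, b1⟩ := L.back x i h1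
  obtain ⟨p2, a2, b2⟩ := L.back x' i h2
  by_cases g1 : G.Adj p1 x'
  · exact ⟨p1, a1.symm, g1, b1⟩
  by_cases g2 : G.Adj p2 x
  · exact ⟨p2, g2, a2.symm, b2⟩
  have := L.comp _ _ a1
  have := L.comp _ _ a2
  exact (L.nested hfast hs i p1 p2 x x' (by omega) b1 b2 h1 h2 a1.symm a2.symm g1 g2).elim

lemma Layering.nocross (L : Layering G s c d) (hfast : Fast G)
    (hs : ∀ u w, G.Adj u w → s w = !s u) (u u' y w : V) (hc : c u = c u') (hd : d u = d u')
    (e1 : G.Adj u y) (hy : d u = d y + 1) (n1 : ¬ G.Adj u' y)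
    (e2 : G.Adj u w) (hw : d w = d u + 1) (n2 : ¬ G.Adj u' w) : False := by
  obtain ⟨x, hx, hdx⟩ := L.back u' (d y) (by omega)
  have c1 := L.comp _ _ e1
  have c2 := L.comp _ _ hx
  have c3 := L.comp _ _ e2
  have hxu : G.Adj x u := by
    by_contra h
    exact L.nested hfast hs (d y) y x u u' (by omega) rfl hdx (by omega) (by omega) e1.symm
      hx.symm (fun h => n1 h.symm) h
  have hxy : x ≠ y := by rintro rfl; exact n1 hx
  have hd0 : d y ≠ 0 := by
    intro h0
    exact hxy (L.root x y (by omega) (by omega) h0)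
  obtain ⟨p, px, py, hp⟩ := L.common hfast hs x y (d y - 1) (by omega) (by omega) (by omega)
  by_cases hz : ∃ z, G.Adj u' z ∧ d z = d u + 1
  · obtain ⟨z, hz, hdz⟩ := hz
    have c4 := L.comp _ _ hz
    have hzu : G.Adj u z := by
      by_contra h
      exact L.nested hfast hs (d u) u u' w z hc rfl (by omega) (by omega) (by omega) e2 hz h n2
    exact stirrer_false hfast.2.1 s hs u x u' z p y w hxu.symm hx.symm hz hzu.symm px.symm py
      e1.symm e2 n1 n2 (L.nadj (by omega) (by omega)) (L.nadj (by omega) (by omega))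
  · push Not at hz
    by_cases h1 : d y = 1
    · have hp0 : d p = 0 := by omega
      have cp := L.comp _ _ py
      refine (L.good p hp0).e3 x u y u' w px hxu e1 py hx.symm e2
        (L.nadj (by omega) (by omega)) n1 ?_
      intro t ht
      have ht1 : d t = 1 := by
        have := hz t ht
        rcases L.step _ _ ht with h | h <;> omega
      obtain ⟨r, hr, hr0⟩ := L.back t 0 ht1
      have ct := L.comp _ _ ht
      have cr := L.comp _ _ hr
      have : r = p := L.root r p (by omega) hr0 hp0
      subst this
      exact hr.symm
    · obtain ⟨q, hq, hdq⟩ := L.back p (d y - 2) (by omega)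
      exact armchair_false hfast.1 s hs p x u y q u' w px hxu e1 py.symm hq hx.symm e2
        (L.nadj (by omega) (by omega)) (L.nadj (by omega) (by omega)) n1
        (L.nadj (by omega) (by omega)) n2

/-- The ordering inside a layer. -/
def LayerLe (G : SimpleGraph V) (d : V → ℕ) (u u' : V) : Prop :=
  (∀ y, d u = d y + 1 → G.Adj u' y → G.Adj u y) ∧ (∀ w, d w = d u + 1 → G.Adj u w → G.Adj u' w)

lemma Layering.total (L : Layering G s c d) (hfast : Fast G)
    (hs : ∀ u w, G.Adj u w → s w = !s u) (u u' : V) (hc : c u = c u') (hd : d u = d u') :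
    LayerLe G d u u' ∨ LayerLe G d u' u := by
  by_contra hcon
  push Not at hcon
  obtain ⟨h1, h2⟩ := hcon
  simp only [LayerLe, not_and_or, not_forall] at h1 h2
  rcases h1 with ⟨y, hy, ey, ny⟩ | ⟨w, hw, ew, nw⟩
  · rcases h2 with ⟨y', hy', ey', ny'⟩ | ⟨w', hw', ew', nw'⟩
    · have := L.comp _ _ ey
      have := L.comp _ _ ey'
      exact L.nested hfast hs (d y) y y' u' u (by omega) rfl (by omega) (by omega) (by omega)
        ey.symm ey'.symm (fun h => ny h.symm) (fun h => ny' h.symm)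
    · exact L.nocross hfast hs u' u y w' hc.symm hd.symm ey (by omega) ny ew' hw' nw'
  · rcases h2 with ⟨y', hy', ey', ny'⟩ | ⟨w', hw', ew', nw'⟩
    · exact L.nocross hfast hs u u' y' w hc hd ey' (by omega) ny' ew hw nw
    · exact L.nested hfast hs (d u) u u' w w' hc rfl (by omega) (by omega) (by omega) ew ew' nw' nw

/-- The strong ordering property. -/
def StrongOrd {α : Type*} [LinearOrder α] (G : SimpleGraph V) (s : V → Bool) (f : V → α) : Prop :=
  ∀ a a' b b', s a = s a' → s b = s b' → f a ≤ f a' → f b ≤ f b' → G.Adj a b' → G.Adj a' b →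
    G.Adj a b ∧ G.Adj a' b'

open Classical in
lemma Layering.strong [Fintype V] (L : Layering G s c d) (hfast : Fast G)
    (hs : ∀ u w, G.Adj u w → s w = !s u) :
    ∃ f : V → ℕ ×ₗ ℕ ×ₗ ℤ, StrongOrd G s f := by
  let up : V → Finset V := fun u => Finset.univ.filter (fun w => d w = d u + 1 ∧ G.Adj u w)
  let dn : V → Finset V := fun u => Finset.univ.filter (fun w => d u = d w + 1 ∧ G.Adj u w)
  have hup : ∀ u w, w ∈ up u ↔ (d w = d u + 1 ∧ G.Adj u w) := by simp [up]
  have hdn : ∀ u w, w ∈ dn u ↔ (d u = d w + 1 ∧ G.Adj u w) := by simp [dn]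
  let f : V → ℕ ×ₗ ℕ ×ₗ ℤ := fun u => toLex (c u, toLex (d u, ((up u).card : ℤ) - (dn u).card))
  have hf : ∀ u w, f u ≤ f w → c u ≤ c w ∧ (c u = c w → d u ≤ d w ∧
      (d u = d w → LayerLe G d u w)) := by
    intro u w h
    simp only [f, Prod.Lex.toLex_le_toLex] at h
    refine ⟨by omega, fun hc => ⟨by omega, fun hd => ?_⟩⟩
    have hle : ((up u).card : ℤ) - (dn u).card ≤ ((up w).card : ℤ) - (dn w).card := by omega
    rcases L.total hfast hs u w hc hd with h1 | h1
    · exact h1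
    · have s1 : up w ⊆ up u := by
        intro t ht
        rw [hup] at ht ⊢
        exact ⟨by omega, h1.2 t ht.1 ht.2⟩
      have s2 : dn u ⊆ dn w := by
        intro t ht
        rw [hdn] at ht ⊢
        exact ⟨by omega, h1.1 t (by omega) ht.2⟩
      have k1 := Finset.card_le_card s1
      have k2 := Finset.card_le_card s2
      have q1 := Finset.eq_of_subset_of_card_le s1 (by omega)
      have q2 := Finset.eq_of_subset_of_card_le s2 (by omega)
      constructor
      · intro y hy e
        have : y ∈ dn w := (hdn _ _).2 ⟨by omega, e⟩
        rw [← q2] at this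
        exact ((hdn _ _).1 this).2
      · intro y hy e
        have : y ∈ up u := (hup _ _).2 ⟨by omega, e⟩
        rw [← q1] at this
        exact ((hup _ _).1 this).2
  refine ⟨f, ?_⟩
  intro a a' b b' sa sb fa fb e1 e2
  obtain ⟨ca, ha⟩ := hf _ _ fa
  obtain ⟨cb, hb⟩ := hf _ _ fb
  have k1 := L.comp _ _ e1
  have k2 := L.comp _ _ e2
  have ca' : c a = c a' := by omega
  have cb' : c b = c b' := by omega
  obtain ⟨da, ha⟩ := ha ca'
  obtain ⟨db, hb⟩ := hb cb'
  have p1 := L.par _ _ ca' sa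
  have p2 := L.par _ _ cb' sb
  have t1 := L.step _ _ e1
  have t2 := L.step _ _ e2
  by_cases hda : d a = d a'
  · have ha := ha hda
    by_cases hdb : d b = d b'
    · have hb := hb hdb
      rcases t1 with t1 | t1
      · exact ⟨(hb.1 a (by omega) e1.symm).symm, ha.2 b' (by omega) e1⟩
      · exact ⟨ha.1 b (by omega) e2, (hb.2 a' (by omega) e2.symm).symm⟩
    · exact ⟨ha.1 b (by omega) e2, ha.2 b' (by omega) e1⟩
  · have hb := hb (by omega)
    exact ⟨(hb.1 a (by omega) e1.symm).symm, (hb.2 a' (by omega) e2.symm).symm⟩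

lemma exists_layering [Fintype V] (hhole : HoleFree G) (hfast : Fast G)
    (hs : ∀ u w, G.Adj u w → s w = !s u) : ∃ c d, Layering G s c d := by
  classical
  have hroot : ∀ C : G.ConnectedComponent, ∃ v, G.connectedComponentMk v = C ∧ GoodRoot G v := by
    intro C
    induction C using SimpleGraph.ConnectedComponent.ind with
    | h v0 =>
      obtain ⟨v, h1, h2⟩ := exists_goodRoot hhole hfast hs v0
      exact ⟨v, (SimpleGraph.ConnectedComponent.sound h1).symm, h2⟩
  choose r hr1 hr2 using hroot
  obtain ⟨n, ⟨e⟩⟩ := Finite.exists_equiv_fin G.ConnectedComponent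
  let c : V → ℕ := fun u => (e (G.connectedComponentMk u)).val
  let ρ : V → V := fun u => r (G.connectedComponentMk u)
  let d : V → ℕ := fun u => G.dist (ρ u) u
  have hc : ∀ u w, c u = c w → G.connectedComponentMk u = G.connectedComponentMk w := by
    intro u w h
    exact e.injective (Fin.ext h)
  have hρ : ∀ u w, c u = c w → ρ u = ρ w := by
    intro u w h
    simp only [ρ, hc u w h]
  have hreach : ∀ u, G.Reachable (ρ u) u := fun u =>
    SimpleGraph.ConnectedComponent.exact (hr1 _)
  have hcomp : ∀ u w, G.Adj u w → c u = c w := by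
    intro u w h
    simp only [c]
    rw [SimpleGraph.ConnectedComponent.sound h.reachable]
  have hback : ∀ u n, d u = n + 1 → ∃ w, G.Adj u w ∧ d w = n := by
    intro u n hu
    obtain ⟨p, hp⟩ := (hreach u).symm.exists_walk_length_eq_dist
    have hl : p.length = n + 1 := by
      rw [hp, SimpleGraph.dist_comm]; exact hu
    have key : ∀ (x : V) (p : G.Walk u x), p.length = n + 1 →
        ∃ w, ∃ _ : G.Adj u w, ∃ q : G.Walk w x, q.length = n := by
      intro x p hp
      cases p with
      | nil => simp at hp
      | @cons _ w _ h q =>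
        simp only [SimpleGraph.Walk.length_cons] at hp
        exact ⟨w, h, q, by omega⟩
    obtain ⟨w, h, q, hq⟩ := key _ p hl
    refine ⟨w, h, ?_⟩
    have hw : ρ w = ρ u := hρ _ _ (hcomp _ _ h).symm
    have h1 : d w ≤ n := by
      have := SimpleGraph.dist_le q.reverse
      simp only [SimpleGraph.Walk.length_reverse] at this
      have e3 : d w = G.dist (ρ u) w := by simp only [d, hw]
      omega
    have h2 : d u ≤ d w + 1 := by
      obtain ⟨q2, hq2⟩ := (hreach w).exists_walk_length_eq_dist
      have := SimpleGraph.dist_le (q2.concat h.symm)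
      rw [SimpleGraph.Walk.length_concat, hq2, hw] at this
      simp only [d, hw]
      exact this
    omega
  have hsucc : ∀ u w, G.Adj u w → d w ≤ d u + 1 := by
    intro u w h
    have hw : ρ w = ρ u := hρ _ _ (hcomp _ _ h).symm
    obtain ⟨q', hq'⟩ := (hreach u).exists_walk_length_eq_dist
    have := SimpleGraph.dist_le (q'.concat h)
    rw [SimpleGraph.Walk.length_concat, hq'] at this
    simp only [d, hw]
    exact this
  have hzero : ∀ u, d u = 0 → ρ u = u := by
    intro u h
    exact ((hreach u).dist_eq_zero_iff).1 h
  have hpar : ∀ n u, d u = n → s u = if n % 2 = 0 then s (ρ u) else !s (ρ u) := by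
    intro n
    induction n with
    | zero => intro u hu; simp [hzero u hu]
    | succ n ih =>
      intro u hu
      obtain ⟨w, hw, hdw⟩ := hback u n hu
      rw [hs _ _ hw.symm, ih w hdw, hρ w u (hcomp _ _ hw.symm)]
      rcases Nat.mod_two_eq_zero_or_one n with h0 | h0
      · rw [if_pos h0, if_neg (by omega)]
      · rw [if_neg (by omega), if_pos (by omega), Bool.not_not]
  have hpar2 : ∀ u w, c u = c w → (s u = s w ↔ d u % 2 = d w % 2) := by
    intro u w h
    rw [hpar _ u rfl, hpar _ w rfl, hρ u w h]
    rcases Nat.mod_two_eq_zero_or_one (d u) with h0 | h0 <;>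
      rcases Nat.mod_two_eq_zero_or_one (d w) with h1 | h1 <;> simp [h0, h1]
  refine ⟨c, d, ⟨hcomp, ?_, ?_, hback, ?_, fun u w h => (hpar2 u w h).1⟩⟩
  · intro u w h h1 h2
    rw [← hzero u h1, ← hzero w h2, hρ u w h]
  · intro u w h
    have h1 := hsucc _ _ h
    have h2 := hsucc _ _ h.symm
    have h3 : ¬ d u % 2 = d w % 2 := fun hh =>
      not_adj_side hs ((hpar2 u w (hcomp _ _ h)).2 hh) h
    have : d u ≠ d w := fun hh => h3 (by rw [hh])
    omega
  · intro u h
    rw [← hzero u h]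
    exact hr2 _

end Aux3

section Aux4

variable {V : Type*} [Fintype V] {G : SimpleGraph V} {α : Type*} [LinearOrder α]
  {s : V → Bool} {f : V → α}

lemma le_psi {A B : Finset V} {d : ℕ} (hA : d ≤ A.card) (hB : d ≤ B.card)
    (h : ∀ a ∈ A, ∀ b ∈ B, G.Adj a b) : d ≤ psi G := by
  obtain ⟨A', hA1, hA2⟩ := Finset.exists_subset_card_eq hA
  obtain ⟨B', hB1, hB2⟩ := Finset.exists_subset_card_eq hB
  apply le_csSup
  · refine ⟨Fintype.card V, ?_⟩
    rintro n ⟨A1, B1, h1, -⟩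
    rw [← h1]
    exact Finset.card_le_univ _
  · refine ⟨A', B', hA2, hB2, ?_, fun a ha b hb => h a (hA1 ha) b (hB1 hb)⟩
    rw [Finset.disjoint_left]
    intro x hx hx'
    exact G.irrefl (h x (hA1 hx) x (hB1 hx'))

open Classical in
/-- Vertices of side `t` in `S` that still have a neighbour outside `S`. -/
noncomputable def act (G : SimpleGraph V) (s : V → Bool) (t : Bool) (S : Finset V) : Finset V :=
  Finset.univ.filter (fun u => u ∈ S ∧ s u = t ∧ ∃ w, w ∉ S ∧ G.Adj u w)

lemma mem_act {t : Bool} {S : Finset V} {u : V} :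
    u ∈ act G s t S ↔ u ∈ S ∧ s u = t ∧ ∃ w, w ∉ S ∧ G.Adj u w := by
  simp [act]

/-- `S` is closed downwards on each side. -/
def DownC (s : V → Bool) (f : V → α) (S : Finset V) : Prop :=
  ∀ u ∈ S, ∀ w, w ∉ S → s u = s w → f u ≤ f w

lemma half_adj (hs : ∀ u w, G.Adj u w → s w = !s u) (hf : StrongOrd G s f) {S : Finset V}
    (hS : DownC s f S) {a0 a b0 b1 x : V} (h0 : G.Adj a0 b0) (hx : x ∉ S) (hxb : G.Adj x b0)
    (haS : a ∈ S) (hsa : s a0 = s a) (hb1 : G.Adj a b1) (hle : f a0 ≤ f a) : G.Adj a b0 := by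
  have e1 := hs _ _ h0
  have e2 := hs _ _ hxb
  have e3 := hs _ _ hb1
  have ex : s a = s x := by
    rw [← hsa]
    rw [e1] at e2
    exact Bool.not_inj e2
  have eb : s b1 = s b0 := by rw [e3, e1, hsa]
  rcases le_total (f b1) (f b0) with h | h
  · exact (hf a0 a b1 b0 hsa eb hle h h0 hb1).2
  · exact (hf a x b0 b1 ex eb.symm (hS a haS x hx ex) h hb1 hxb).1

lemma exists_act_lt (hs : ∀ u w, G.Adj u w → s w = !s u) (hf : StrongOrd G s f)
    (hpsi : 1 ≤ psi G) {S : Finset V} (hS : DownC s f S) :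
    ∃ t, (act G s t S).card < psi G := by
  classical
  by_contra! hcon
  have ht := hcon true
  have hff := hcon false
  obtain ⟨a0, ha0, hamin⟩ := Finset.exists_min_image (act G s true S) f
    (Finset.card_pos.1 (by omega))
  obtain ⟨b0, hb0, hbmin⟩ := Finset.exists_min_image (act G s false S) f
    (Finset.card_pos.1 (by omega))
  obtain ⟨ha0S, ha0s, b', hb'S, hab'⟩ := mem_act.1 ha0
  obtain ⟨hb0S, hb0s, a', ha'S, hba'⟩ := mem_act.1 hb0
  have hall : ∀ a b a1 b1, a ∈ S → b ∈ S → s a = true → s b = false → b1 ∉ S → a1 ∉ S →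
      G.Adj a b1 → G.Adj b a1 → G.Adj a b ∧ G.Adj a1 b1 := by
    intro a b a1 b1 ha hb hsa hsb hb1 ha1 h1 h2
    have e1 := hs _ _ h1
    have e2 := hs _ _ h2
    have e3 : s a = s a1 := by rw [e2, hsa, hsb]; rfl
    have e4 : s b = s b1 := by rw [e1, hsa, hsb]; rfl
    exact hf a a1 b b1 e3 e4 (hS a ha a1 ha1 e3) (hS b hb b1 hb1 e4) h1 h2.symm
  have hab : G.Adj a' b' := (hall a0 b0 a' b' ha0S hb0S ha0s hb0s hb'S ha'S hab' hba').2
  have key : psi G + 1 ≤ psi G := by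
    refine le_psi (A := insert a' (act G s true S)) (B := insert b' (act G s false S)) ?_ ?_ ?_
    · rw [Finset.card_insert_of_notMem (fun h => ha'S (mem_act.1 h).1)]
      omega
    · rw [Finset.card_insert_of_notMem (fun h => hb'S (mem_act.1 h).1)]
      omega
    · intro a ha b hb
      rw [Finset.mem_insert] at ha hb
      rcases ha with rfl | ha <;> rcases hb with rfl | hb
      · exact hab
      · obtain ⟨hbS, hbs, a1, ha1S, hba1⟩ := mem_act.1 hb
        exact (half_adj hs hf hS hba' hb'S hab.symm hbS (by rw [hb0s, hbs]) hba1
          (hbmin b hb)).symm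
      · obtain ⟨haS, has, b1, hb1S, hab1⟩ := mem_act.1 ha
        exact half_adj hs hf hS hab' ha'S hab haS (by rw [ha0s, has]) hab1 (hamin a ha)
      · obtain ⟨hbS, hbs, a1, ha1S, hba1⟩ := mem_act.1 hb
        obtain ⟨haS, has, b1, hb1S, hab1⟩ := mem_act.1 ha
        exact (hall a b a1 b1 haS hbS has hbs hb1S ha1S hab1 hba1).1
  omega

/-- The invariant kept by the sweep. -/
def SweepInv (G : SimpleGraph V) (s : V → Bool) (f : V → α) (S : Finset V) : Prop :=
  DownC s f S ∧ ∀ t, (act G s t S).card ≤ psi G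

open Classical in
lemma sweep_add {S : Finset V} (hI : SweepInv G s f S) {t : Bool}
    (ht : (act G s t S).card < psi G) (hv : ∃ v, v ∉ S ∧ s v = t) :
    ∃ v, v ∉ S ∧ SweepInv G s f (insert v S) := by
  obtain ⟨v0, hv0⟩ := hv
  obtain ⟨v, hv, hmin⟩ := Finset.exists_min_image
    (Finset.univ.filter (fun v => v ∉ S ∧ s v = t)) f ⟨v0, by simpa using hv0⟩
  simp only [Finset.mem_filter, Finset.mem_univ, true_and] at hv hmin
  refine ⟨v, hv.1, ?_, ?_⟩
  · intro u hu w hw hsw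
    rw [Finset.mem_insert] at hu hw
    push Not at hw
    rcases hu with rfl | hu
    · exact hmin w ⟨hw.2, by rw [← hsw, hv.2]⟩
    · exact hI.1 u hu w hw.2 hsw
  · intro t'
    by_cases h : t' = t
    · subst h
      have : act G s t' (insert v S) ⊆ insert v (act G s t' S) := by
        intro u hu
        obtain ⟨h1, h2, w, h3, h4⟩ := mem_act.1 hu
        rw [Finset.mem_insert] at h1 h3 ⊢
        push Not at h3
        rcases h1 with h1 | h1
        · exact Or.inl h1
        · exact Or.inr (mem_act.2 ⟨h1, h2, w, h3.2, h4⟩)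
      have h5 := Finset.card_le_card this
      have h6 := Finset.card_insert_le v (act G s t' S)
      omega
    · refine le_trans (Finset.card_le_card ?_) (hI.2 t')
      intro u hu
      obtain ⟨h1, h2, w, h3, h4⟩ := mem_act.1 hu
      rw [Finset.mem_insert] at h1 h3
      push Not at h3
      rcases h1 with h1 | h1
      · subst h1
        exact absurd (h2.symm.trans hv.2) h
      · exact mem_act.2 ⟨h1, h2, w, h3.2, h4⟩

open Classical in
lemma sweep_step (hs : ∀ u w, G.Adj u w → s w = !s u) (hf : StrongOrd G s f)
    (hpsi : 1 ≤ psi G) {S : Finset V} (hI : SweepInv G s f S) (hS : S ≠ Finset.univ) :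
    ∃ v, v ∉ S ∧ SweepInv G s f (insert v S) := by
  obtain ⟨t, ht⟩ := exists_act_lt hs hf hpsi hI.1
  by_cases hv : ∃ v, v ∉ S ∧ s v = t
  · exact sweep_add hI ht hv
  · push Not at hv
    obtain ⟨v, hvS⟩ : ∃ v, v ∉ S := by
      by_contra! h
      exact hS (Finset.eq_univ_iff_forall.2 h)
    have h0 : act G s (!t) S = ∅ := by
      rw [Finset.eq_empty_iff_forall_notMem]
      intro u hu
      obtain ⟨h1, h2, w, h3, h4⟩ := mem_act.1 hu
      apply hv w h3
      rw [hs _ _ h4, h2, Bool.not_not]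
    refine sweep_add hI (t := !t) (by rw [h0, Finset.card_empty]; omega) ⟨v, hvS, ?_⟩
    have := hv v hvS
    revert this
    cases s v <;> cases t <;> simp

open Classical in
lemma exists_sweep (hs : ∀ u w, G.Adj u w → s w = !s u) (hf : StrongOrd G s f)
    (hpsi : 1 ≤ psi G) : ∃ S : ℕ → Finset V, S 0 = ∅ ∧ (∀ i, SweepInv G s f (S i)) ∧
      (∀ i, S i ⊆ S (i + 1)) ∧ (∀ i, (S (i + 1) \ S i).card ≤ 1) ∧
      S (Fintype.card V) = Finset.univ := by
  have hex : ∀ S : {S : Finset V // SweepInv G s f S}, ∃ S' : {S : Finset V // SweepInv G s f S},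
      S.1 ⊆ S'.1 ∧ (S'.1 \ S.1).card ≤ 1 ∧ (S.1 ≠ Finset.univ → S.1.card < S'.1.card) := by
    rintro ⟨S, hI⟩
    by_cases h : S = Finset.univ
    · exact ⟨⟨S, hI⟩, by simp, by simp, fun h' => absurd h h'⟩
    · obtain ⟨v, hv, hI'⟩ := sweep_step hs hf hpsi hI h
      refine ⟨⟨insert v S, hI'⟩, Finset.subset_insert _ _, ?_, fun _ => ?_⟩
      · refine le_trans (Finset.card_le_card (t := {v}) ?_) (by simp)
        intro x hx
        simp only [Finset.mem_sdiff, Finset.mem_insert, Finset.mem_singleton] at hx ⊢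
        tauto
      · simp only
        rw [Finset.card_insert_of_notMem hv]
        omega
  choose nx hn1 hn2 hn3 using hex
  have hE : SweepInv G s f (∅ : Finset V) := by
    refine ⟨fun u hu => absurd hu (by simp), fun t => ?_⟩
    have : act G s t ∅ = ∅ := by
      rw [Finset.eq_empty_iff_forall_notMem]
      intro u hu
      exact absurd (mem_act.1 hu).1 (by simp)
    simp [this]
  let T : ℕ → {S : Finset V // SweepInv G s f S} := fun i => nx^[i] ⟨∅, hE⟩
  have hT : ∀ i, T (i + 1) = nx (T i) := fun i => Function.iterate_succ_apply' nx i _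
  have hcard : ∀ i, i ≤ Fintype.card V → i ≤ (T i).1.card := by
    intro i
    induction i with
    | zero => intro _; exact Nat.zero_le _
    | succ i ih =>
      intro hi
      rw [hT]
      have h1 := ih (by omega)
      by_cases h : (T i).1 = Finset.univ
      · have := Finset.card_le_card (hn1 (T i))
        rw [h, Finset.card_univ] at this
        omega
      · have := hn3 _ h
        omega
  refine ⟨fun i => (T i).1, rfl, fun i => (T i).2, fun i => ?_, fun i => ?_, ?_⟩
  · simp only [hT]; exact hn1 _
  · simp only [hT]; exact hn2 _
  · apply Finset.eq_univ_of_card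
    exact le_antisymm (Finset.card_le_univ _) (hcard _ le_rfl)

open Classical in
lemma pathwidth_le_of_strong (hs : ∀ u w, G.Adj u w → s w = !s u) (hf : StrongOrd G s f)
    (hpsi : 1 ≤ psi G) (hV : 0 < Fintype.card V) : pathwidth G ≤ 2 * psi G - 1 := by
  obtain ⟨S, hS0, hI, hsub, hone, hfin⟩ := exists_sweep hs hf hpsi
  have hmono : Monotone S := monotone_nat_of_le_succ hsub
  -- entering index
  have hent : ∀ v, ∃ i, i < Fintype.card V ∧ v ∉ S i ∧ v ∈ S (i + 1) := by
    intro v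
    have hex : ∃ n, v ∈ S n := ⟨Fintype.card V, by rw [hfin]; simp⟩
    have h1 := Nat.find_spec hex
    have h2 : Nat.find hex ≤ Fintype.card V := Nat.find_min' hex (by rw [hfin]; simp)
    have h0 : Nat.find hex ≠ 0 := by
      intro h
      rw [h, hS0] at h1
      simp at h1
    obtain ⟨i, hi⟩ := Nat.exists_eq_succ_of_ne_zero h0
    rw [hi] at h1 h2
    exact ⟨i, by omega, Nat.find_min hex (by omega), h1⟩
  let bag : ℕ → Finset V := fun i =>
    (act G s true (S i) ∪ act G s false (S i)) ∪ (S (i + 1) \ S i)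
  have hbag : ∀ v i, v ∈ bag i ↔
      (v ∈ S i ∧ ∃ w, w ∉ S i ∧ G.Adj v w) ∨ (v ∈ S (i + 1) ∧ v ∉ S i) := by
    intro v i
    simp only [bag, Finset.mem_union, Finset.mem_sdiff, mem_act]
    cases s v <;> simp
  have hedge : ∀ u v i j, G.Adj u v → v ∉ S j → v ∈ S (j + 1) → u ∉ S i → u ∈ S (i + 1) →
      i ≤ j → u ∈ bag j ∧ v ∈ bag j := by
    intro u v i j h h1 h2 h3 h4 hij
    refine ⟨(hbag u j).2 ?_, (hbag v j).2 (Or.inr ⟨h2, h1⟩)⟩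
    rcases hij.eq_or_lt with rfl | hlt
    · exact Or.inr ⟨h4, h3⟩
    · exact Or.inl ⟨hmono hlt h4, v, h1, h⟩
  let D : PathDecomp G :=
    { len := Fintype.card V
      len_pos := hV
      bags := fun i => bag i
      mem_bag := by
        intro v
        obtain ⟨i, hi, h1, h2⟩ := hent v
        exact ⟨⟨i, hi⟩, (hbag v i).2 (Or.inr ⟨h2, h1⟩)⟩
      edge_bag := by
        intro u v h
        obtain ⟨i, hi, h1, h2⟩ := hent u
        obtain ⟨j, hj, h3, h4⟩ := hent v
        rcases le_total i j with hij | hij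
        · exact ⟨⟨j, hj⟩, hedge u v i j h h3 h4 h1 h2 hij⟩
        · exact ⟨⟨i, hi⟩, (hedge v u j i h.symm h1 h2 h3 h4 hij).symm⟩
      interval := by
        intro v i j k hij hjk hi hk
        have hij' : (i : ℕ) ≤ j := hij
        have hjk' : (j : ℕ) ≤ k := hjk
        rcases hij'.eq_or_lt with e | hij'
        · rwa [← Fin.ext e]
        rcases hjk'.eq_or_lt with e | hjk'
        · rwa [Fin.ext e]
        have hv : v ∈ S j := by
          rcases (hbag v i).1 hi with h | h
          · exact hmono hij'.le h.1
          · exact hmono hij' h.1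
        refine (hbag v j).2 (Or.inl ⟨hv, ?_⟩)
        rcases (hbag v k).1 hk with ⟨-, w, hw, hvw⟩ | h
        · exact ⟨w, fun h => hw (hmono hjk'.le h), hvw⟩
        · exact absurd (hmono hjk'.le hv) h.2 }
  have hsize : ∀ i, (bag i).card ≤ 2 * psi G := by
    intro i
    have h1 : (act G s true (S i)).card + (act G s false (S i)).card < 2 * psi G := by
      obtain ⟨t, ht⟩ := exists_act_lt hs hf hpsi (hI i).1
      have ha := (hI i).2 true
      have hb := (hI i).2 false
      cases t <;> omega
    have h2 := Finset.card_union_le (act G s true (S i) ∪ act G s false (S i)) (S (i + 1) \ S i)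
    have h3 := Finset.card_union_le (act G s true (S i)) (act G s false (S i))
    have h4 := hone i
    change (act G s true (S i) ∪ act G s false (S i) ∪ S (i + 1) \ S i).card ≤ _
    omega
  have hw : pathwidth G ≤ D.width := Nat.sInf_le ⟨D, rfl⟩
  refine hw.trans (Nat.sub_le_sub_right ?_ 1)
  exact Finset.sup_le fun i _ => hsize i

lemma psi_pos_of_adj {u v : V} (h : G.Adj u v) : 1 ≤ psi G := by
  refine le_psi (A := {u}) (B := {v}) (by simp) (by simp) ?_
  intro a ha b hb
  rw [Finset.mem_singleton] at ha hb
  rwa [ha, hb]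

lemma exists_side (hbip : IsBipartiteGraph G) :
    ∃ s : V → Bool, ∀ u w, G.Adj u w → s w = !s u := by
  classical
  obtain ⟨A, B, hAB, -, hA, hB⟩ := hbip
  refine ⟨fun u => decide (u ∈ A), fun u w h => ?_⟩
  have hu : u ∈ A ∪ B := by rw [hAB]; trivial
  have hw : w ∈ A ∪ B := by rw [hAB]; trivial
  by_cases h1 : u ∈ A
  · have h2 : w ∉ A := fun h2 => hA h1 h2 h
    simp [h1, h2]
  · have h2 : w ∈ A := by
      by_contra h2
      exact hB (hu.resolve_left h1) (hw.resolve_left h2) h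
    simp [h1, h2]

end Aux4

/-- Every bipartite, hole-free, fast finite simple graph `G` with at least
one edge satisfies `pw(G) ≤ 2·ψ(G) − 1`. -/
theorem fast_holeFree_pathwidth_le_two_psi_sub_one {V : Type*} [Fintype V]
    (G : SimpleGraph V) (hbip : IsBipartiteGraph G) (hhole : HoleFree G) (hfast : Fast G)
    (hedge : ∃ u v : V, G.Adj u v) :
    pathwidth G ≤ 2 * psi G - 1 := by
  obtain ⟨u, v, huv⟩ := hedge
  obtain ⟨s, hs⟩ := exists_side hbip
  obtain ⟨c, d, L⟩ := exists_layering hhole hfast hs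
  obtain ⟨f, hf⟩ := L.strong hfast hs
  exact pathwidth_le_of_strong hs hf (psi_pos_of_adj huv) (Fintype.card_pos_iff.2 ⟨u⟩)
end
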